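/- There is an absolute constant C > 0 such that the following holds. Let q be an integer that is either 1 or prime, let z ≥ 2 and y ≥ 3 be reals, and let a, b be coprime integers with 1 < b ≤ (log y)^{100}. Then |∑_{n ≤ z, P⁺(n) ≤ y, gcd(n,q) = 1} e(na/b)/n + (𝟙_{b = q}/φ(q))·∑_{n ≤ z, P⁺(n) ≤ y, gcd(n,q) = 1} 1/n| ≤ C·(1 + (𝟙_{q > 1}/q)·(b/φ(b)))·log log y, where both sums are over positive integers n ≤ z coprime to q all of whose prime factors are at most y. -/

import Mathlib

open Real Complex MeasureTheory
open scoped BigOperators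

attribute [local instance] Classical.propDecidable

/-- `e(x) = exp(2πix)` -/
noncomputable def e2pi (x : ℝ) : ℂ := Complex.exp (2 * Real.pi * Complex.I * x)

/-- `∑_{n ≤ x} χ(n)` -/
noncomputable def charSum {q : ℕ} (χ : DirichletCharacter ℂ q) (x : ℝ) : ℂ :=
  ∑ n ∈ Finset.Icc 1 ⌊x⌋₊, χ (n : ZMod q)

/-- `M(χ) = max_{1 ≤ N ≤ q} |∑_{n ≤ N} χ(n)|` -/
noncomputable def Mchi {q : ℕ} (χ : DirichletCharacter ℂ q) : ℝ :=
  ⨆ N ∈ Finset.Icc 1 q, ‖charSum χ (N : ℝ)‖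

/-- `m(χ) = π M(χ)/(e^γ √q)` -/
noncomputable def mchi {q : ℕ} (χ : DirichletCharacter ℂ q) : ℝ :=
  Real.pi * Mchi χ / (Real.exp Real.eulerMascheroniConstant * Real.sqrt q)

/-- the modified Bessel function `I₀` -/
noncomputable def I0 (t : ℝ) : ℝ := ∑' n : ℕ, (t ^ 2 / 4) ^ n / ((n.factorial : ℝ)) ^ 2

/-- the constant `A` -/
noncomputable def Aconst : ℝ :=
  Real.log 2 - 1 - (∫ t in (0:ℝ)..2, Real.log (I0 t) / t ^ 2)
    - ∫ t in Set.Ioi (2:ℝ), (Real.log (I0 t) - t) / t ^ 2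

/-- `Φ_q(τ)` -/
noncomputable def Phi (q : ℕ) (τ : ℝ) : ℝ :=
  (Nat.card {χ : DirichletCharacter ℂ q // χ ≠ 1 ∧ τ < mchi χ} : ℝ) / q.totient

/-- `S_𝒜(χ) = max_{α ∈ [0,1]} |∑_{n ∈ 𝒜} χ(n) e(nα)/n|` -/
noncomputable def SA {q : ℕ} (χ : DirichletCharacter ℂ q) (A : Finset ℕ) : ℝ :=
  ⨆ α : Set.Icc (0:ℝ) 1, ‖∑ n ∈ A, χ (n : ZMod q) * e2pi (n * (α : ℝ)) / n‖

/-- `S_{y,z}(χ)` -/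
noncomputable def Syz {q : ℕ} (χ : DirichletCharacter ℂ q) (y z : ℝ) : ℝ :=
  SA χ ((Finset.Icc 1 ⌊z⌋₊).filter fun n => ∃ p : ℕ, p.Prime ∧ p ∣ n ∧ y < (p : ℝ))

/-- `L(1,χ)` -/
noncomputable def Lone {q : ℕ} (χ : DirichletCharacter ℂ q) : ℂ :=
  ∑' n : ℕ, χ (n : ZMod q) / n

/-- the Gauss sum `G(χ) = ∑_{a=1}^{q} χ(a) e(a/q)` -/
noncomputable def gaussS {q : ℕ} (χ : DirichletCharacter ℂ q) : ℂ :=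
  ∑ a ∈ Finset.Icc 1 q, χ (a : ZMod q) * e2pi ((a : ℝ) / q)

/-- the pretentious distance `𝔻(χ, ξ; y)` -/
noncomputable def Ddist {q D : ℕ} (χ : DirichletCharacter ℂ q) (ξ : DirichletCharacter ℂ D)
    (y : ℝ) : ℝ :=
  Real.sqrt (∑ p ∈ (Finset.Icc 1 ⌊y⌋₊).filter Nat.Prime,
    (1 - (χ (p : ZMod q) * (starRingEnd ℂ) (ξ (p : ZMod D))).re) / p)

/-! ### Exponential sums at roots of unity -/

/-- Summation by parts for `∑ ζ ^ m / m`. -/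
lemma norm_one_sub_mul_sum_pow_div_le {ζ : ℂ} (hζ : ‖ζ‖ = 1) {K M : ℕ} (hKM : K ≤ M) :
    ‖(1 - ζ) * ∑ m ∈ Finset.Ioc K M, ζ ^ m / m + ζ ^ (M + 1) / ((M + 1 : ℕ) : ℂ)‖ ≤
      2 / (K + 1 : ℝ) - 1 / (M + 1 : ℝ) := by
  induction M, hKM using Nat.le_induction with
  | base =>
    simp only [Finset.Ioc_self, Finset.sum_empty, mul_zero, zero_add, norm_div, norm_pow, hζ,
      one_pow, Complex.norm_natCast]
    push_cast
    rw [← sub_div]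
    norm_num
  | succ M hM ih =>
    have hM1 : ((M : ℂ) + 1) ≠ 0 := by exact_mod_cast Nat.succ_ne_zero M
    have hM2 : ((M : ℂ) + 1 + 1) ≠ 0 := by exact_mod_cast Nat.succ_ne_zero (M + 1)
    have hsplit : (1 - ζ) * ∑ m ∈ Finset.Ioc K (M + 1), ζ ^ m / m +
        ζ ^ (M + 1 + 1) / ((M + 1 + 1 : ℕ) : ℂ) =
        ((1 - ζ) * ∑ m ∈ Finset.Ioc K M, ζ ^ m / m + ζ ^ (M + 1) / ((M + 1 : ℕ) : ℂ)) +
        -(ζ ^ (M + 2)) * ((1 / (M + 1 : ℝ) - 1 / (M + 1 + 1 : ℝ) : ℝ) : ℂ) := by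
      rw [← Finset.sum_Ioc_consecutive _ hM (Nat.le_succ M)]
      simp only [Nat.Ioc_succ_singleton, Finset.sum_singleton]
      push_cast
      field_simp
      ring
    rw [hsplit]
    refine (norm_add_le _ _).trans ?_
    have hnn : 0 ≤ 1 / (M + 1 : ℝ) - 1 / (M + 1 + 1 : ℝ) := by
      rw [sub_nonneg]
      apply one_div_le_one_div_of_le <;> linarith [Nat.cast_nonneg (α := ℝ) M]
    rw [norm_mul, norm_neg, norm_pow, hζ, one_pow, one_mul, Complex.norm_real,
      Real.norm_of_nonneg hnn]
    push_cast at *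
    linarith

lemma sum_Icc_one_div_le (M : ℕ) : ∑ m ∈ Finset.Icc 1 M, (1 : ℝ) / m ≤ 1 + Real.log M := by
  have h := harmonic_le_one_add_log M
  rw [harmonic_eq_sum_Icc] at h
  push_cast at h
  simpa [one_div] using h

lemma norm_sum_pow_div_le {ζ : ℂ} (hζ : ‖ζ‖ = 1) (hne : ζ ≠ 1) (M : ℕ) :
    ‖∑ m ∈ Finset.Icc 1 M, ζ ^ m / m‖ ≤ Real.log (2 / ‖1 - ζ‖) + 2 := by
  have hδ : 0 < ‖1 - ζ‖ := norm_pos_iff.2 (sub_ne_zero.2 hne.symm)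
  have hδ2 : ‖1 - ζ‖ ≤ 2 := by
    refine (norm_sub_le _ _).trans ?_
    rw [hζ, norm_one]; norm_num
  have h1 : 1 ≤ 2 / ‖1 - ζ‖ := by rwa [le_div_iff₀ hδ, one_mul]
  have short : ∀ N : ℕ, (N : ℝ) ≤ 2 / ‖1 - ζ‖ →
      ‖∑ m ∈ Finset.Icc 1 N, ζ ^ m / m‖ ≤ 1 + Real.log (2 / ‖1 - ζ‖) := by
    intro N hN
    have : ‖∑ m ∈ Finset.Icc 1 N, ζ ^ m / m‖ ≤ ∑ m ∈ Finset.Icc 1 N, (1 : ℝ) / m := by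
      refine (norm_sum_le _ _).trans (Finset.sum_le_sum fun m _ => ?_)
      simp [hζ]
    refine this.trans ((sum_Icc_one_div_le N).trans ?_)
    rcases Nat.eq_zero_or_pos N with rfl | hpos
    · simpa using Real.log_nonneg h1
    · have : (0 : ℝ) < N := by exact_mod_cast hpos
      gcongr
  by_cases hM : (M : ℝ) ≤ 2 / ‖1 - ζ‖
  · linarith [short M hM]
  · push Not at hM
    set K := ⌊2 / ‖1 - ζ‖⌋₊ with hK
    have hKle : (K : ℝ) ≤ 2 / ‖1 - ζ‖ := Nat.floor_le (by positivity)
    have hKlt : 2 / ‖1 - ζ‖ < K + 1 := Nat.lt_floor_add_one _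
    have hKM : K ≤ M := by
      have : (K : ℝ) < M := hKle.trans_lt hM
      exact_mod_cast this.le
    have hsplit : ∑ m ∈ Finset.Icc 1 M, ζ ^ m / m =
        ∑ m ∈ Finset.Icc 1 K, ζ ^ m / m + ∑ m ∈ Finset.Ioc K M, ζ ^ m / m := by
      have := Finset.sum_Ioc_consecutive (fun m : ℕ => ζ ^ m / m) (Nat.zero_le K) hKM
      exact this.symm
    have htail : ‖∑ m ∈ Finset.Ioc K M, ζ ^ m / m‖ ≤ 1 := by
      have h := norm_one_sub_mul_sum_pow_div_le hζ hKM
      have h' : ‖(1 - ζ) * ∑ m ∈ Finset.Ioc K M, ζ ^ m / m‖ ≤ 2 / (K + 1 : ℝ) := by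
        have h2 : ‖ζ ^ (M + 1) / ((M + 1 : ℕ) : ℂ)‖ = 1 / (M + 1 : ℝ) := by
          rw [norm_div, norm_pow, hζ, one_pow, Complex.norm_natCast]
          push_cast
          rfl
        have h3 := norm_le_add_norm_add ((1 - ζ) * ∑ m ∈ Finset.Ioc K M, ζ ^ m / m)
          (ζ ^ (M + 1) / ((M + 1 : ℕ) : ℂ))
        linarith
      rw [norm_mul] at h'
      have h4 : 2 / (K + 1 : ℝ) ≤ ‖1 - ζ‖ := by
        rw [div_lt_iff₀ hδ] at hKlt
        rw [div_le_iff₀ (by positivity)]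
        linarith
      have := h'.trans h4
      exact le_of_mul_le_mul_left (by linarith) hδ
    rw [hsplit]
    have := norm_add_le (∑ m ∈ Finset.Icc 1 K, ζ ^ m / m) (∑ m ∈ Finset.Ioc K M, ζ ^ m / m)
    linarith [short K hKle]

lemma two_div_norm_one_sub_le {ζ : ℂ} {b : ℕ} (hb : 1 < b) (hζ : IsPrimitiveRoot ζ b) :
    2 / ‖1 - ζ‖ ≤ b := by
  have hne : ζ ≠ 1 := hζ.ne_one hb
  have hn : ‖ζ‖ = 1 := hζ.norm'_eq_one (by lia)
  have hδ : 0 < ‖1 - ζ‖ := norm_pos_iff.2 (sub_ne_zero.2 hne.symm)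
  have hterm : ∀ j : ℕ, ‖1 - ζ ^ j‖ ≤ j * ‖1 - ζ‖ := by
    intro j
    have h : 1 - ζ ^ j = (1 - ζ) * ∑ i ∈ Finset.range j, ζ ^ i := (mul_neg_geom_sum ζ j).symm
    rw [h, norm_mul, mul_comm]
    gcongr
    refine (norm_sum_le _ _).trans ?_
    simp [hn]
  have hsum : (b : ℂ) = ∑ j ∈ Finset.range b, (1 - ζ ^ j) := by
    rw [Finset.sum_sub_distrib, hζ.geom_sum_eq_zero hb]
    simp
  have h1 : (b : ℝ) ≤ (∑ j ∈ Finset.range b, (j : ℝ)) * ‖1 - ζ‖ := by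
    calc (b : ℝ) = ‖(b : ℂ)‖ := by simp
      _ ≤ ∑ j ∈ Finset.range b, ‖1 - ζ ^ j‖ := by rw [hsum]; exact norm_sum_le _ _
      _ ≤ ∑ j ∈ Finset.range b, (j : ℝ) * ‖1 - ζ‖ := Finset.sum_le_sum fun j _ => hterm j
      _ = _ := by rw [Finset.sum_mul]
  have h2 : (∑ j ∈ Finset.range b, (j : ℝ)) * 2 = b * (b - 1) := by
    have := Finset.sum_range_id_mul_two b
    have h3 : ((∑ j ∈ Finset.range b, j : ℕ) : ℝ) * 2 = ((b * (b - 1) : ℕ) : ℝ) := by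
      exact_mod_cast this
    rw [Nat.cast_mul, Nat.cast_sub hb.le] at h3
    push_cast at h3
    exact h3
  have hb0 : (0 : ℝ) < b := by positivity
  rw [div_le_iff₀ hδ]
  have h3 : (b : ℝ) * 2 ≤ b * (b * ‖1 - ζ‖) := by nlinarith
  exact le_of_mul_le_mul_left h3 hb0

/-- The value `Φ_b(1)` is a nonzero integer, hence the average of `log (2 / |1 - ζ|)` over the
primitive roots of unity of order `b` is at most `log 2`. -/
lemma sum_primitiveRoots_log_le {b : ℕ} (hb : 1 < b) :
    ∑ ζ ∈ primitiveRoots b ℂ, Real.log (2 / ‖1 - ζ‖) ≤ b.totient * Real.log 2 := by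
  have hprim := Complex.isPrimitiveRoot_exp b (by lia)
  have hne : ∀ ζ ∈ primitiveRoots b ℂ, ‖1 - ζ‖ ≠ 0 := by
    intro ζ hζ
    have := (isPrimitiveRoot_of_mem_primitiveRoots hζ).ne_one hb
    exact norm_ne_zero_iff.2 (sub_ne_zero.2 this.symm)
  have hprod : ∏ ζ ∈ primitiveRoots b ℂ, ‖1 - ζ‖ =
      |(((Polynomial.cyclotomic b ℤ).eval 1 : ℤ) : ℝ)| := by
    have h1 : (Polynomial.cyclotomic b ℂ).eval 1 = ∏ ζ ∈ primitiveRoots b ℂ, (1 - ζ) := by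
      rw [Polynomial.cyclotomic_eq_prod_X_sub_primitiveRoots hprim, Polynomial.eval_prod]
      simp
    have h2 : (Polynomial.cyclotomic b ℂ).eval 1 = (((Polynomial.cyclotomic b ℤ).eval 1 : ℤ) : ℂ) := by
      rw [← Polynomial.map_cyclotomic_int b ℂ, Polynomial.eval_one_map]
      simp
    rw [← norm_prod, ← h1, h2, Complex.norm_intCast]
  have hz : (Polynomial.cyclotomic b ℤ).eval 1 ≠ 0 := by
    intro h
    rw [h] at hprod
    simp only [Int.cast_zero, abs_zero] at hprod
    exact (Finset.prod_ne_zero_iff.2 hne) hprod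
  have hge : 1 ≤ ∏ ζ ∈ primitiveRoots b ℂ, ‖1 - ζ‖ := by
    rw [hprod]
    exact_mod_cast Int.one_le_abs hz
  have hlog : 0 ≤ ∑ ζ ∈ primitiveRoots b ℂ, Real.log ‖1 - ζ‖ := by
    rw [← Real.log_prod hne]
    exact Real.log_nonneg hge
  have : ∑ ζ ∈ primitiveRoots b ℂ, Real.log (2 / ‖1 - ζ‖) =
      ∑ ζ ∈ primitiveRoots b ℂ, (Real.log 2 - Real.log ‖1 - ζ‖) :=
    Finset.sum_congr rfl fun ζ hζ => Real.log_div two_ne_zero (hne ζ hζ)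
  rw [this, Finset.sum_sub_distrib, Finset.sum_const, hprim.card_primitiveRoots, nsmul_eq_mul]
  linarith

/-! ### Harmonic sums over arithmetic progressions -/

lemma exists_filter_modEq_Ioc_eq_singleton {m : ℕ} (hm : 0 < m) (c N : ℕ) :
    ∃ k ∈ Finset.Ioc N (N + m), (Finset.Ioc N (N + m)).filter (· ≡ c [MOD m]) = {k} := by
  have hcard : ((Finset.Ioc N (N + m)).filter (· ≡ c [MOD m])).card = 1 := by
    have hI : Finset.Ioc N (N + m) = Finset.Ico (N + 1) (N + 1 + m) := by
      ext; simp only [Finset.mem_Ioc, Finset.mem_Ico]; lia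
    have hper : Function.Periodic (· ≡ c [MOD m]) m := by
      intro x
      simp [Nat.ModEq]
    have h := Nat.filter_Ico_card_eq_of_periodic (N + 1) m (· ≡ c [MOD m]) hper
    rw [Nat.count_modEq_card _ hm, Nat.div_self hm, Nat.mod_self] at h
    rw [hI]
    simpa using h
  obtain ⟨k, hk⟩ := Finset.card_eq_one.1 hcard
  refine ⟨k, ?_, hk⟩
  have : k ∈ (Finset.Ioc N (N + m)).filter (· ≡ c [MOD m]) := by rw [hk]; simp
  exact (Finset.mem_filter.1 this).1

lemma sum_filter_modEq_bounds {m : ℕ} (hm : 0 < m) (c M : ℕ) :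
    ∀ N : ℕ, 0 < N → N ≤ M →
      Real.log (M / (N + m : ℕ)) / m ≤
        ∑ n ∈ (Finset.Ioc N M).filter (· ≡ c [MOD m]), (1 : ℝ) / n ∧
      ∑ n ∈ (Finset.Ioc N M).filter (· ≡ c [MOD m]), (1 : ℝ) / n ≤
        1 / N + Real.log (M / N) / m := by
  have hm' : (0 : ℝ) < m := by exact_mod_cast hm
  suffices H : ∀ j N : ℕ, M - N = j → 0 < N → N ≤ M →
      Real.log (M / (N + m : ℕ)) / m ≤
        ∑ n ∈ (Finset.Ioc N M).filter (· ≡ c [MOD m]), (1 : ℝ) / n ∧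
      ∑ n ∈ (Finset.Ioc N M).filter (· ≡ c [MOD m]), (1 : ℝ) / n ≤
        1 / N + Real.log (M / N) / m from fun N => H _ N rfl
  intro j
  induction j using Nat.strong_induction_on with
  | _ j ih =>
  intro N hj hN hNM
  have hN' : (0 : ℝ) < N := by exact_mod_cast hN
  have hM' : (0 : ℝ) < M := by exact_mod_cast hN.trans_le hNM
  obtain ⟨k, hk, hset⟩ := exists_filter_modEq_Ioc_eq_singleton hm c N
  rw [Finset.mem_Ioc] at hk
  have hk1 : (N : ℝ) ≤ k := by exact_mod_cast hk.1.le
  have hk2 : (k : ℝ) ≤ N + m := by exact_mod_cast hk.2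
  have hkN : (1 : ℝ) / k ≤ 1 / N := one_div_le_one_div_of_le hN' hk1
  rcases lt_or_ge M (N + m) with hlt | hge
  · have hlt' : (M : ℝ) ≤ (N + m : ℕ) := by exact_mod_cast hlt.le
    constructor
    · refine le_trans ?_ (Finset.sum_nonneg fun n _ => by positivity)
      refine div_nonpos_of_nonpos_of_nonneg (Real.log_nonpos (by positivity) ?_) hm'.le
      exact div_le_one_of_le₀ hlt' (by positivity)
    · have hsub : (Finset.Ioc N M).filter (· ≡ c [MOD m]) ⊆ {k} := by
        rw [← hset]
        exact Finset.filter_subset_filter _ (Finset.Ioc_subset_Ioc_right hlt.le)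
      have h1 : ∑ n ∈ (Finset.Ioc N M).filter (· ≡ c [MOD m]), (1 : ℝ) / n ≤ 1 / k := by
        refine (Finset.sum_le_sum_of_subset_of_nonneg hsub fun n _ _ => by positivity).trans ?_
        simp
      have h2 : 0 ≤ Real.log (M / N) / m := by
        refine div_nonneg (Real.log_nonneg ?_) hm'.le
        rw [le_div_iff₀ hN', one_mul]
        exact_mod_cast hNM
      linarith
  · obtain ⟨hlo, hup⟩ := ih (M - (N + m)) (by lia) (N + m) rfl (by lia) hge
    have hsplit : ∑ n ∈ (Finset.Ioc N M).filter (· ≡ c [MOD m]), (1 : ℝ) / n =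
        1 / k + ∑ n ∈ (Finset.Ioc (N + m) M).filter (· ≡ c [MOD m]), (1 : ℝ) / n := by
      have h := Finset.sum_Ioc_consecutive
        (fun n : ℕ => if n ≡ c [MOD m] then (1 : ℝ) / n else 0) (Nat.le_add_right N m) hge
      rw [← Finset.sum_filter, ← Finset.sum_filter, ← Finset.sum_filter, hset,
        Finset.sum_singleton] at h
      exact h.symm
    rw [hsplit]
    have hNm : (0 : ℝ) < (N + m : ℕ) := by positivity
    have hkpos : (0 : ℝ) < k := hN'.trans_le hk1
    constructor
    · have h1 : (1 : ℝ) / (N + m : ℕ) ≤ 1 / k := by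
        apply one_div_le_one_div_of_le hkpos
        exact_mod_cast hk.2
      have h2 : Real.log (M / (N + m : ℕ)) =
          Real.log (M / (N + m + m : ℕ)) + Real.log ((N + m + m : ℕ) / (N + m : ℕ)) := by
        rw [← Real.log_mul (by positivity) (by positivity)]
        congr 1
        field_simp
      have h3 : Real.log ((N + m + m : ℕ) / (N + m : ℕ)) ≤ m / (N + m : ℕ) := by
        refine (Real.log_le_sub_one_of_pos (by positivity)).trans (le_of_eq ?_)
        push_cast at hNm ⊢
        field_simp
        ring
      have h4 : Real.log ((N + m + m : ℕ) / (N + m : ℕ)) / m ≤ 1 / (N + m : ℕ) := by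
        rw [div_le_iff₀ hm']
        calc _ ≤ (m : ℝ) / (N + m : ℕ) := h3
          _ = _ := by ring
      rw [h2, add_div]
      linarith
    · have h2 : Real.log (M / N) = Real.log (M / (N + m : ℕ)) + Real.log ((N + m : ℕ) / N) := by
        rw [← Real.log_mul (by positivity) (by positivity)]
        congr 1
        field_simp
      have h3 : (m : ℝ) / (N + m : ℕ) ≤ Real.log ((N + m : ℕ) / N) := by
        have h := Real.one_sub_inv_le_log_of_pos (x := ((N + m : ℕ) : ℝ) / N) (by positivity)
        refine le_trans (le_of_eq ?_) h
        push_cast at hNm ⊢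
        field_simp
        ring
      have h4 : (1 : ℝ) / (N + m : ℕ) ≤ Real.log ((N + m : ℕ) / N) / m := by
        rw [le_div_iff₀ hm']
        calc _ = (m : ℝ) / (N + m : ℕ) := by ring
          _ ≤ _ := h3
      rw [h2, add_div]
      linarith

lemma abs_sum_filter_modEq_sub_le {m N M : ℕ} (hm : 0 < m) (c : ℕ) (hN : 0 < N) (hNM : N ≤ M) :
    |∑ n ∈ (Finset.Ioc N M).filter (· ≡ c [MOD m]), (1 : ℝ) / n - Real.log (M / N) / m| ≤
      1 / N := by
  obtain ⟨hlo, hup⟩ := sum_filter_modEq_bounds hm c M N hN hNM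
  have hm' : (0 : ℝ) < m := by exact_mod_cast hm
  have hN' : (0 : ℝ) < N := by exact_mod_cast hN
  have hM' : (0 : ℝ) < M := by exact_mod_cast hN.trans_le hNM
  have h2 : Real.log (M / N) = Real.log (M / (N + m : ℕ)) + Real.log ((N + m : ℕ) / N) := by
    rw [← Real.log_mul (by positivity) (by positivity)]
    congr 1
    field_simp
  have h3 : Real.log ((N + m : ℕ) / N) / m ≤ 1 / N := by
    rw [div_le_iff₀ hm']
    refine (Real.log_le_sub_one_of_pos (by positivity)).trans (le_of_eq ?_)
    push_cast
    field_simp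
    ring
  rw [abs_le]
  constructor
  · rw [h2, add_div]; linarith
  · linarith

/-! ### Sums over integers composed of a given set of primes -/

/-- A finite sum of a nonnegative completely multiplicative function over integers supported on a
finite set of primes is at most the Euler product. -/
lemma sum_le_prod_one_sub_inv {f : ℕ →* ℝ} (hf0 : ∀ n, 0 ≤ f n)
    (hf1 : ∀ p : ℕ, p.Prime → f p < 1) (s T : Finset ℕ)
    (hT : ∀ n ∈ T, n ≠ 0 ∧ ∀ p : ℕ, p.Prime → p ∣ n → p ∈ s) :
    ∑ n ∈ T, f n ≤ ∏ p ∈ s with p.Prime, (1 - f p)⁻¹ := by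
  have h := (EulerProduct.summable_and_hasSum_factoredNumbers_prod_filter_prime_geometric
    (f := f) (fun {p} hp => by rw [Real.norm_of_nonneg (hf0 p)]; exact hf1 p hp) s).2
  have hmem : ∀ n ∈ T, n ∈ Nat.factoredNumbers s := by
    intro n hn
    rw [Nat.mem_factoredNumbers']
    exact (hT n hn).2
  have hs := sum_le_hasSum (T.subtype (· ∈ Nat.factoredNumbers s)) (fun m _ => hf0 m) h
  rw [Finset.sum_subtype_of_mem f hmem] at hs
  exact hs

/-- The completely multiplicative function `n ↦ 1 / n`. -/
noncomputable def invHom : ℕ →* ℝ where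
  toFun n := 1 / n
  map_one' := by simp
  map_mul' a b := by push_cast; rw [one_div_mul_one_div]

lemma invHom_apply (n : ℕ) : invHom n = 1 / n := rfl

lemma sum_one_div_le_prod (s T : Finset ℕ)
    (hT : ∀ n ∈ T, n ≠ 0 ∧ ∀ p : ℕ, p.Prime → p ∣ n → p ∈ s) :
    ∑ n ∈ T, (1 : ℝ) / n ≤ ∏ p ∈ s with p.Prime, (1 - (1 : ℝ) / p)⁻¹ := by
  refine sum_le_prod_one_sub_inv (f := invHom) (fun n => ?_) (fun p hp => ?_) s T hT
  · rw [invHom_apply]; positivity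
  · rw [invHom_apply, div_lt_one (by exact_mod_cast hp.pos)]
    exact_mod_cast hp.one_lt

lemma sum_one_div_le_div_totient {m : ℕ} (hm : m ≠ 0) (T : Finset ℕ)
    (hT : ∀ n ∈ T, n ≠ 0 ∧ ∀ p : ℕ, p.Prime → p ∣ n → p ∣ m) :
    ∑ n ∈ T, (1 : ℝ) / n ≤ m / m.totient := by
  refine (sum_one_div_le_prod m.primeFactors T fun n hn =>
    ⟨(hT n hn).1, fun p hp hpn => Nat.mem_primeFactors.2 ⟨hp, (hT n hn).2 p hp hpn, hm⟩⟩).trans ?_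
  rw [Finset.filter_true_of_mem fun p hp => Nat.prime_of_mem_primeFactors hp]
  have h := Nat.totient_eq_mul_prod_factors m
  have h' : (m.totient : ℝ) = m * ∏ p ∈ m.primeFactors, (1 - (1 : ℝ) / p) := by
    have := congrArg (fun x : ℚ => (x : ℝ)) h
    push_cast at this
    simpa [one_div] using this
  have hm' : (m : ℝ) ≠ 0 := by exact_mod_cast hm
  have hφ : (m.totient : ℝ) ≠ 0 := by
    exact_mod_cast (Nat.totient_pos.2 (Nat.pos_of_ne_zero hm)).ne'
  rw [Finset.prod_inv_distrib]
  rw [h'] at hφ ⊢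
  have := right_ne_zero_of_mul hφ
  apply le_of_eq
  field_simp

/-! ### Reciprocals of primes and smooth numbers -/

lemma sum_one_div_primes_dyadic_le (K : ℕ) :
    ∑ p ∈ (Finset.Ioc (2 ^ (K + 1)) (2 ^ (K + 2))).filter Nat.Prime, (1 : ℝ) / p ≤ 4 / (K + 1 : ℝ) := by
  have hl2 : 0 < Real.log 2 := Real.log_pos one_lt_two
  have hX : (0 : ℝ) < 2 ^ (K + 1) * ((K + 1) * Real.log 2) := by positivity
  have hθ : ∑ p ∈ (Finset.Ioc (2 ^ (K + 1)) (2 ^ (K + 2))).filter Nat.Prime, Real.log p ≤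
      2 * Real.log 2 * 2 ^ (K + 2) := by
    have h := Chebyshev.theta_le_log4_mul_x (x := ((2 ^ (K + 2) : ℕ) : ℝ)) (Nat.cast_nonneg _)
    have h4 : Real.log 4 = 2 * Real.log 2 := by
      rw [show (4 : ℝ) = 2 ^ 2 by norm_num, Real.log_pow]
      norm_num
    rw [Chebyshev.theta, Nat.floor_natCast, h4] at h
    push_cast at h
    refine le_trans (Finset.sum_le_sum_of_subset_of_nonneg ?_ fun p _ _ =>
      Real.log_natCast_nonneg p) h
    exact Finset.filter_subset_filter _ (Finset.Ioc_subset_Ioc_left (Nat.zero_le _))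
  have hterm : ∀ p ∈ (Finset.Ioc (2 ^ (K + 1)) (2 ^ (K + 2))).filter Nat.Prime,
      (1 : ℝ) / p ≤ Real.log p / (2 ^ (K + 1) * ((K + 1) * Real.log 2)) := by
    intro p hp
    rw [Finset.mem_filter, Finset.mem_Ioc] at hp
    have hp1 : (2 : ℝ) ^ (K + 1) ≤ p := by exact_mod_cast hp.1.1.le
    have hp0 : (0 : ℝ) < p := by exact_mod_cast hp.2.pos
    have hlog : (K + 1) * Real.log 2 ≤ Real.log p := by
      have := Real.log_le_log (by positivity) hp1
      rw [Real.log_pow] at this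
      exact_mod_cast this
    rw [div_le_div_iff₀ hp0 hX, one_mul]
    rw [mul_comm (Real.log _)]
    gcongr
  refine (Finset.sum_le_sum hterm).trans ?_
  rw [← Finset.sum_div, div_le_iff₀ hX]
  refine hθ.trans (le_of_eq ?_)
  field_simp
  ring

lemma sum_one_div_primes_two_pow_le (K : ℕ) :
    ∑ p ∈ (Finset.Ioc 0 (2 ^ (K + 1))).filter Nat.Prime, (1 : ℝ) / p ≤
      1 / 2 + 4 * ∑ k ∈ Finset.Icc 1 K, (1 : ℝ) / k := by
  induction K with
  | zero =>
    have : (Finset.Ioc 0 (2 ^ (0 + 1))).filter Nat.Prime = {2} := by decide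
    rw [this]
    simp
  | succ K ih =>
    have h := Finset.sum_Ioc_consecutive
      (fun p : ℕ => if p.Prime then (1 : ℝ) / p else 0) (Nat.zero_le (2 ^ (K + 1)))
      (Nat.pow_le_pow_right (n := 2) (by norm_num) (Nat.le_succ (K + 1)))
    rw [← Finset.sum_filter, ← Finset.sum_filter, ← Finset.sum_filter] at h
    rw [← h, Finset.sum_Icc_succ_top (by lia)]
    have h2 := sum_one_div_primes_dyadic_le K
    push_cast
    have : (4 : ℝ) * (1 / (K + 1)) = 4 / (K + 1) := by ring
    linarith

lemma sum_one_div_primes_le {y : ℝ} (hy : 3 ≤ y) :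
    ∑ p ∈ (Finset.Ioc 0 ⌊y⌋₊).filter Nat.Prime, (1 : ℝ) / p ≤ 4 * Real.log (Real.log y) + 9 := by
  set K := Nat.log 2 ⌊y⌋₊ with hK
  have hy2 : 2 ≤ ⌊y⌋₊ := Nat.le_floor (by norm_num; linarith)
  have hK1 : 1 ≤ K := by
    exact Nat.log_pos one_lt_two hy2
  have hlt : ⌊y⌋₊ < 2 ^ (K + 1) := Nat.lt_pow_succ_log_self (by norm_num) _
  have hle : (2 : ℝ) ^ K ≤ y := by
    have h1 : 2 ^ K ≤ ⌊y⌋₊ := Nat.pow_log_le_self 2 (by lia)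
    calc (2 : ℝ) ^ K = ((2 ^ K : ℕ) : ℝ) := by push_cast; rfl
      _ ≤ (⌊y⌋₊ : ℝ) := by exact_mod_cast h1
      _ ≤ y := Nat.floor_le (by linarith)
  have hly : 0 < Real.log y := Real.log_pos (by linarith)
  have hKle : (K : ℝ) ≤ 2 * Real.log y := by
    have h := Real.log_le_log (by positivity) hle
    rw [Real.log_pow] at h
    nlinarith [Real.log_two_gt_d9]
  have hK0 : (0 : ℝ) < K := by exact_mod_cast hK1
  have hlogK : Real.log K ≤ 1 + Real.log (Real.log y) := by
    have h := Real.log_le_log hK0 hKle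
    rw [Real.log_mul two_ne_zero hly.ne'] at h
    linarith [Real.log_two_lt_d9]
  have h1 : ∑ p ∈ (Finset.Ioc 0 ⌊y⌋₊).filter Nat.Prime, (1 : ℝ) / p ≤
      ∑ p ∈ (Finset.Ioc 0 (2 ^ (K + 1))).filter Nat.Prime, (1 : ℝ) / p :=
    Finset.sum_le_sum_of_subset_of_nonneg
      (Finset.filter_subset_filter _ (Finset.Ioc_subset_Ioc_right hlt.le))
      fun p _ _ => by positivity
  linarith [sum_one_div_primes_two_pow_le K, sum_Icc_one_div_le K]

/-- The positive integers up to `Z` all of whose prime factors are at most `y`. -/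
noncomputable def smoothUpTo (y : ℝ) (Z : ℕ) : Finset ℕ :=
  (Finset.Icc 1 Z).filter fun n => ∀ p : ℕ, p.Prime → p ∣ n → (p : ℝ) ≤ y

lemma mem_smoothUpTo {y : ℝ} {Z n : ℕ} :
    n ∈ smoothUpTo y Z ↔ (1 ≤ n ∧ n ≤ Z) ∧ ∀ p : ℕ, p.Prime → p ∣ n → (p : ℝ) ≤ y := by
  rw [smoothUpTo, Finset.mem_filter, Finset.mem_Icc]

/-- The completely multiplicative function `n ↦ n ^ s`. -/
noncomputable def rpowHom (s : ℝ) : ℕ →* ℝ where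
  toFun n := (n : ℝ) ^ s
  map_one' := by simp
  map_mul' a b := by
    push_cast
    exact Real.mul_rpow (Nat.cast_nonneg a) (Nat.cast_nonneg b)

lemma rpowHom_apply (s : ℝ) (n : ℕ) : rpowHom s n = (n : ℝ) ^ s := rfl

/-- Rankin's bound for the tail of the sum of reciprocals of smooth numbers. -/
lemma sum_smooth_tail_le {y u : ℝ} (hy : 3 ≤ y) (hly : 2 ≤ Real.log y) (Z : ℕ) :
    ∑ n ∈ (smoothUpTo y Z).filter (fun n : ℕ => y ^ u ≤ (n : ℝ)), (1 : ℝ) / n ≤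
      Real.exp (-u) * Real.exp (12 * (4 * Real.log (Real.log y) + 9)) := by
  set σ := 1 / Real.log y with hσ
  have hy0 : 0 < y := by linarith
  have hl0 : 0 < Real.log y := by linarith
  have hσ0 : 0 < σ := by positivity
  have hσ2 : σ ≤ 1 / 2 := one_div_le_one_div_of_le two_pos hly
  have hyσ : ∀ v : ℝ, (y ^ v) ^ σ = Real.exp v := by
    intro v
    rw [← Real.rpow_mul hy0.le, Real.rpow_def_of_pos hy0, hσ]
    congr 1
    field_simp
  set T := (smoothUpTo y Z).filter (fun n : ℕ => y ^ u ≤ (n : ℝ)) with hT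
  have hterm : ∀ n ∈ T, (1 : ℝ) / n ≤ Real.exp (-u) * rpowHom (σ - 1) n := by
    intro n hn
    rw [hT, Finset.mem_filter, mem_smoothUpTo] at hn
    have hn0 : (0 : ℝ) < n := by exact_mod_cast hn.1.1.1
    have h1 : Real.exp u ≤ (n : ℝ) ^ σ := by
      rw [← hyσ u]
      exact Real.rpow_le_rpow (by positivity) hn.2 hσ0.le
    rw [rpowHom_apply, Real.rpow_sub_one hn0.ne', Real.exp_neg, ← mul_div_assoc]
    gcongr
    rw [inv_mul_eq_div, le_div_iff₀ (Real.exp_pos u)]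
    linarith
  refine (Finset.sum_le_sum hterm).trans ?_
  rw [← Finset.mul_sum]
  gcongr
  have hhalf : ∀ p : ℕ, p.Prime → rpowHom (σ - 1) p ≤ 3 / 4 := by
    intro p hp
    have hp2 : (2 : ℝ) ≤ p := by exact_mod_cast hp.two_le
    rw [rpowHom_apply]
    calc (p : ℝ) ^ (σ - 1) ≤ (p : ℝ) ^ (-(1 / 2) : ℝ) :=
          Real.rpow_le_rpow_of_exponent_le (by linarith) (by linarith)
      _ ≤ (2 : ℝ) ^ (-(1 / 2) : ℝ) :=
          Real.rpow_le_rpow_of_nonpos two_pos hp2 (by norm_num)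
      _ ≤ 3 / 4 := by
          rw [Real.rpow_neg two_pos.le, ← Real.sqrt_eq_rpow]
          rw [inv_le_comm₀ (by positivity) (by norm_num)]
          apply Real.le_sqrt_of_sq_le
          norm_num
  have hnn : ∀ n : ℕ, 0 ≤ rpowHom (σ - 1) n := fun n =>
    Real.rpow_nonneg (Nat.cast_nonneg n) _
  refine (sum_le_prod_one_sub_inv hnn (fun p hp => (hhalf p hp).trans_lt (by norm_num))
    (Finset.Ioc 0 ⌊y⌋₊) T ?_).trans ?_
  · intro n hn
    rw [hT, Finset.mem_filter, mem_smoothUpTo] at hn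
    refine ⟨by lia, fun p hp hpn => ?_⟩
    rw [Finset.mem_Ioc]
    exact ⟨hp.pos, Nat.le_floor (hn.1.2 p hp hpn)⟩
  · calc ∏ p ∈ Finset.Ioc 0 ⌊y⌋₊ with p.Prime, (1 - rpowHom (σ - 1) p)⁻¹
        ≤ ∏ p ∈ Finset.Ioc 0 ⌊y⌋₊ with p.Prime, Real.exp (12 * (1 / (p : ℝ))) := by
          refine Finset.prod_le_prod (fun p hp => ?_) (fun p hp => ?_)
          · rw [Finset.mem_filter] at hp
            have := hhalf p hp.2
            rw [inv_nonneg]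
            linarith
          · rw [Finset.mem_filter, Finset.mem_Ioc] at hp
            have hx := hhalf p hp.2
            have hx0 := hnn p
            have hp0 : (0 : ℝ) < p := by exact_mod_cast hp.2.pos
            have hpy : (p : ℝ) ≤ y := (Nat.le_floor_iff hy0.le).1 hp.1.2
            have hx3 : rpowHom (σ - 1) p ≤ 3 * (1 / (p : ℝ)) := by
              rw [rpowHom_apply, Real.rpow_sub_one hp0.ne', mul_one_div]
              gcongr
              calc (p : ℝ) ^ σ ≤ y ^ σ := Real.rpow_le_rpow hp0.le hpy hσ0.le
                _ = Real.exp 1 := by rw [← hyσ 1, Real.rpow_one]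
                _ ≤ 3 := by linarith [Real.exp_one_lt_d9]
            set x := rpowHom (σ - 1) p
            have h1 : (1 - x)⁻¹ ≤ 1 + 4 * x := by
              rw [inv_le_iff_one_le_mul₀ (by linarith)]
              nlinarith
            calc (1 - x)⁻¹ ≤ 1 + 4 * x := h1
              _ ≤ 4 * x + 1 := by linarith
              _ ≤ Real.exp (4 * x) := Real.add_one_le_exp _
              _ ≤ _ := Real.exp_le_exp.2 (by linarith)
      _ = Real.exp (12 * ∑ p ∈ (Finset.Ioc 0 ⌊y⌋₊).filter Nat.Prime, (1 / (p : ℝ))) := by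
          rw [← Real.exp_sum, Finset.mul_sum]
      _ ≤ _ := by
          rw [Real.exp_le_exp]
          gcongr
          exact sum_one_div_primes_le hy

lemma sum_smooth_one_div_le_prod {y Y : ℝ} (hyY : y ≤ Y) (Z : ℕ) :
    ∑ n ∈ smoothUpTo y Z, (1 : ℝ) / n ≤
      ∏ p ∈ Finset.Ioc 0 ⌊Y⌋₊ with p.Prime, (1 - (1 : ℝ) / p)⁻¹ := by
  refine sum_one_div_le_prod _ _ fun n hn => ?_
  rw [mem_smoothUpTo] at hn
  refine ⟨by lia, fun p hp hpn => Finset.mem_Ioc.2 ⟨hp.pos, Nat.le_floor ?_⟩⟩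
  exact (hn.2 p hp hpn).trans hyY

/-! ### Selberg's upper bound sieve in arithmetic progressions -/

/-- The squarefree integers up to `R` that are coprime to `b`. -/
noncomputable def sieveSupport (b R : ℕ) : Finset ℕ :=
  (Finset.Icc 1 R).filter fun l => Squarefree l ∧ l.Coprime b

lemma mem_sieveSupport {b R l : ℕ} :
    l ∈ sieveSupport b R ↔ (1 ≤ l ∧ l ≤ R) ∧ Squarefree l ∧ l.Coprime b := by
  rw [sieveSupport, Finset.mem_filter, Finset.mem_Icc]

lemma mem_sieveSupport_of_dvd {b R d l : ℕ} (hl : l ∈ sieveSupport b R) (hd : d ∣ l) :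
    d ∈ sieveSupport b R := by
  rw [mem_sieveSupport] at hl ⊢
  refine ⟨⟨Nat.pos_of_dvd_of_pos hd hl.1.1, (Nat.le_of_dvd hl.1.1 hd).trans hl.1.2⟩,
    hl.2.1.squarefree_of_dvd hd, hl.2.2.coprime_dvd_left hd⟩

/-- The total mass `∑ 1 / φ(l)` over the support of the sieve. -/
noncomputable def sieveMass (b R : ℕ) : ℝ := ∑ l ∈ sieveSupport b R, (1 : ℝ) / l.totient

/-- The squarefree part of `n` away from `b`: the product of the primes dividing `n` but not
`b`. -/
noncomputable def radAway (b n : ℕ) : ℕ := ∏ p ∈ n.primeFactors.filter (fun p => ¬ p ∣ b), p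

lemma radAway_dvd (b n : ℕ) : radAway b n ∣ n :=
  (Finset.prod_dvd_prod_of_subset _ _ _ (Finset.filter_subset _ _)).trans
    (Nat.prod_primeFactors_dvd n)

lemma radAway_mem_sieveSupport {b R n : ℕ} (hn : n ∈ Finset.Icc 1 R) :
    radAway b n ∈ sieveSupport b R := by
  rw [Finset.mem_Icc] at hn
  rw [mem_sieveSupport]
  have hdvd := radAway_dvd b n
  refine ⟨⟨Nat.pos_of_dvd_of_pos hdvd hn.1, (Nat.le_of_dvd hn.1 hdvd).trans hn.2⟩, ?_, ?_⟩
  · refine Finset.squarefree_prod_of_pairwise_isCoprime (fun p hp k hk hpk => ?_) fun p hp => ?_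
    · rw [Finset.mem_coe, Finset.mem_filter] at hp hk
      exact Nat.coprime_iff_isRelPrime.1 ((Nat.coprime_primes (Nat.prime_of_mem_primeFactors hp.1)
        (Nat.prime_of_mem_primeFactors hk.1)).2 hpk)
    · exact (Nat.prime_of_mem_primeFactors (Finset.mem_filter.1 hp).1).squarefree
  · refine Nat.Coprime.prod_left fun p hp => ?_
    rw [Finset.mem_filter] at hp
    exact ((Nat.prime_of_mem_primeFactors hp.1).coprime_iff_not_dvd).2 hp.2

lemma sum_fiber_radAway_le {b R l : ℕ} (hb : 0 < b) (hl : l ∈ sieveSupport b R) :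
    ∑ n ∈ (Finset.Icc 1 R).filter (fun n => radAway b n = l), (1 : ℝ) / n ≤
      (b : ℝ) / b.totient * (1 / l.totient) := by
  rw [mem_sieveSupport] at hl
  have hl0 : 0 < l := hl.1.1
  have hl' : (0 : ℝ) < l := by exact_mod_cast hl0
  set T := (Finset.Icc 1 R).filter (fun n => radAway b n = l) with hT
  have hdvd : ∀ n ∈ T, l ∣ n := by
    intro n hn
    rw [← (Finset.mem_filter.1 hn).2]
    exact radAway_dvd b n
  have hinj : Set.InjOn (fun n => n / l) T := by
    intro x hx z hz hxz
    exact (Nat.div_left_inj (hdvd x hx) (hdvd z hz)).1 hxz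
  have h1 : ∑ n ∈ T, (1 : ℝ) / n = 1 / l * ∑ k ∈ T.image (fun n => n / l), (1 : ℝ) / k := by
    rw [Finset.sum_image hinj, Finset.mul_sum]
    refine Finset.sum_congr rfl fun n hn => ?_
    rw [Nat.cast_div (hdvd n hn) hl'.ne']
    field_simp
  have h2 : ∑ k ∈ T.image (fun n => n / l), (1 : ℝ) / k ≤ (l * b : ℕ) / (l * b).totient := by
    refine sum_one_div_le_div_totient (Nat.mul_pos hl0 hb).ne' _ fun k hk => ?_
    obtain ⟨n, hn, rfl⟩ := Finset.mem_image.1 hk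
    have hn1 := Finset.mem_filter.1 hn
    rw [Finset.mem_Icc] at hn1
    refine ⟨(Nat.div_pos (Nat.le_of_dvd hn1.1.1 (hdvd n hn)) hl0).ne', fun p hp hpn => ?_⟩
    have hpn' : p ∣ n := hpn.trans (Nat.div_dvd_of_dvd (hdvd n hn))
    by_cases hpb : p ∣ b
    · exact hpb.mul_left l
    · refine Dvd.dvd.mul_right ?_ b
      rw [← hn1.2]
      refine Finset.dvd_prod_of_mem (fun p : ℕ => p) ?_
      rw [Finset.mem_filter, Nat.mem_primeFactors]
      exact ⟨⟨hp, hpn', by lia⟩, hpb⟩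
  rw [h1]
  calc 1 / (l : ℝ) * ∑ k ∈ T.image (fun n => n / l), (1 : ℝ) / k
      ≤ 1 / (l : ℝ) * ((l * b : ℕ) / (l * b).totient) := by gcongr
    _ = _ := by
      rw [Nat.totient_mul hl.2.2]
      have h3 : (b.totient : ℝ) ≠ 0 := by exact_mod_cast (Nat.totient_pos.2 hb).ne'
      have h4 : (l.totient : ℝ) ≠ 0 := by exact_mod_cast (Nat.totient_pos.2 hl0).ne'
      push_cast
      field_simp

lemma log_le_mul_sieveMass {b : ℕ} (hb : 0 < b) (R : ℕ) :
    Real.log R ≤ (b : ℝ) / b.totient * sieveMass b R := by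
  have h1 : Real.log R ≤ ∑ n ∈ Finset.Icc 1 R, (1 : ℝ) / n := by
    have h := log_add_one_le_harmonic R
    rw [harmonic_eq_sum_Icc] at h
    push_cast at h
    simp only [one_div]
    refine le_trans ?_ h
    rcases Nat.eq_zero_or_pos R with rfl | hR
    · simp
    · have : (0 : ℝ) < R := by exact_mod_cast hR
      exact Real.log_le_log this (by linarith)
  refine h1.trans ?_
  rw [sieveMass, Finset.mul_sum,
    ← Finset.sum_fiberwise_of_maps_to fun n hn => radAway_mem_sieveSupport (b := b) hn]
  exact Finset.sum_le_sum fun l hl => sum_fiber_radAway_le hb hl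

lemma sum_moebius_filter_dvd {k l : ℕ} (hk : Squarefree k) :
    ∑ d ∈ k.divisors.filter (l ∣ ·), ArithmeticFunction.moebius d =
      if k = l then ArithmeticFunction.moebius l else 0 := by
  have hk0 : k ≠ 0 := hk.ne_zero
  by_cases hlk : l ∣ k
  · obtain ⟨m, rfl⟩ := hlk
    have hl0 : l ≠ 0 := left_ne_zero_of_mul hk0
    have hm0 : m ≠ 0 := right_ne_zero_of_mul hk0
    have hcop : l.Coprime m := Nat.coprime_of_squarefree_mul hk
    have hset : (l * m).divisors.filter (l ∣ ·) = m.divisors.image (l * ·) := by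
      ext d
      simp only [Finset.mem_filter, Nat.mem_divisors, Finset.mem_image]
      constructor
      · rintro ⟨⟨hd, _⟩, e, rfl⟩
        exact ⟨e, ⟨Nat.dvd_of_mul_dvd_mul_left (Nat.pos_of_ne_zero hl0) hd, hm0⟩, rfl⟩
      · rintro ⟨e, ⟨he, _⟩, rfl⟩
        exact ⟨⟨mul_dvd_mul_left l he, hk0⟩, dvd_mul_right l e⟩
    have hinj : Set.InjOn (l * ·) (m.divisors : Set ℕ) := fun x _ z _ h =>
      Nat.eq_of_mul_eq_mul_left (Nat.pos_of_ne_zero hl0) h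
    rw [hset, Finset.sum_image hinj]
    have hmul : ∀ e ∈ m.divisors, ArithmeticFunction.moebius (l * e) =
        ArithmeticFunction.moebius l * ArithmeticFunction.moebius e := fun e he =>
      ArithmeticFunction.isMultiplicative_moebius.map_mul_of_coprime
        (hcop.coprime_dvd_right (Nat.dvd_of_mem_divisors he))
    rw [Finset.sum_congr rfl hmul, ← Finset.mul_sum, ← ArithmeticFunction.coe_mul_zeta_apply,
      ArithmeticFunction.moebius_mul_coe_zeta, ArithmeticFunction.one_apply]
    by_cases hm1 : m = 1
    · simp [hm1]
    · have : l * m ≠ l := by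
        intro h
        exact hm1 (Nat.eq_of_mul_eq_mul_left (Nat.pos_of_ne_zero hl0) (by lia))
      simp [hm1, this]
  · have h1 : k.divisors.filter (l ∣ ·) = ∅ := by
      refine Finset.filter_eq_empty_iff.2 fun d hd hld => ?_
      exact hlk (hld.trans (Nat.dvd_of_mem_divisors hd))
    have h2 : k ≠ l := fun h => hlk (h ▸ dvd_rfl)
    rw [h1, if_neg h2, Finset.sum_empty]

/-- Selberg's weights. -/
noncomputable def selbergWeight (b R d : ℕ) : ℝ :=
  ArithmeticFunction.moebius d * d / sieveMass b R *
    ∑ l ∈ (sieveSupport b R).filter (d ∣ ·), (1 : ℝ) / l.totient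

lemma one_mem_sieveSupport {b R : ℕ} (hR : 1 ≤ R) : 1 ∈ sieveSupport b R := by
  simp [mem_sieveSupport, hR]

lemma sieveMass_pos {b R : ℕ} (hR : 1 ≤ R) : 0 < sieveMass b R := by
  refine Finset.sum_pos (fun l hl => ?_) ⟨1, one_mem_sieveSupport hR⟩
  have := Nat.totient_pos.2 (mem_sieveSupport.1 hl).1.1
  positivity

lemma selbergWeight_one {b R : ℕ} (hR : 1 ≤ R) : selbergWeight b R 1 = 1 := by
  have h := (sieveMass_pos (b := b) hR).ne'
  have hf : (sieveSupport b R).filter (1 ∣ ·) = sieveSupport b R := by simp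
  rw [selbergWeight, hf, ← sieveMass]
  simp [h]

lemma abs_selbergWeight_le {b R : ℕ} (hR : 1 ≤ R) (d : ℕ) : |selbergWeight b R d| ≤ d := by
  have hL := sieveMass_pos (b := b) hR
  have hnn : 0 ≤ ∑ l ∈ (sieveSupport b R).filter (d ∣ ·), (1 : ℝ) / l.totient :=
    Finset.sum_nonneg fun l _ => by positivity
  have hle : ∑ l ∈ (sieveSupport b R).filter (d ∣ ·), (1 : ℝ) / l.totient ≤ sieveMass b R :=
    Finset.sum_le_sum_of_subset_of_nonneg (Finset.filter_subset _ _) fun l _ _ => by positivity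
  have hμ : |((ArithmeticFunction.moebius d : ℤ) : ℝ)| ≤ 1 := by
    exact_mod_cast ArithmeticFunction.abs_moebius_le_one
  rw [selbergWeight, abs_mul, abs_div, abs_mul, abs_of_pos hL, abs_of_nonneg hnn, Nat.abs_cast,
    div_mul_eq_mul_div, div_le_iff₀ hL]
  gcongr
  exact mul_le_of_le_one_left (Nat.cast_nonneg d) hμ

lemma sum_selbergWeight_div {b R l : ℕ} (hl : l ∈ sieveSupport b R) :
    ∑ d ∈ (sieveSupport b R).filter (l ∣ ·), selbergWeight b R d / d =
      ArithmeticFunction.moebius l / (sieveMass b R * l.totient) := by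
  have h1 : ∀ d ∈ (sieveSupport b R).filter (l ∣ ·), selbergWeight b R d / d =
      ∑ k ∈ sieveSupport b R, 1 / sieveMass b R *
        (if d ∣ k then (1 : ℝ) / k.totient * ArithmeticFunction.moebius d else 0) := by
    intro d hd
    rw [Finset.mem_filter, mem_sieveSupport] at hd
    have hd0 : (d : ℝ) ≠ 0 := by
      have : d ≠ 0 := by lia
      exact_mod_cast this
    rw [selbergWeight, ← Finset.mul_sum, ← Finset.sum_filter, ← Finset.sum_mul]
    field_simp
  rw [Finset.sum_congr rfl h1, Finset.sum_comm]
  have h2 : ∀ k ∈ sieveSupport b R, ∑ d ∈ (sieveSupport b R).filter (l ∣ ·),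
      1 / sieveMass b R *
        (if d ∣ k then (1 : ℝ) / k.totient * ArithmeticFunction.moebius d else 0) =
      if k = l then ArithmeticFunction.moebius l / (sieveMass b R * l.totient) else 0 := by
    intro k hk
    have hset : ((sieveSupport b R).filter (l ∣ ·)).filter (· ∣ k) =
        k.divisors.filter (l ∣ ·) := by
      ext d
      simp only [Finset.mem_filter, Nat.mem_divisors]
      constructor
      · rintro ⟨⟨_, h⟩, h'⟩
        exact ⟨⟨h', by have := (mem_sieveSupport.1 hk).1.1; lia⟩, h⟩
      · rintro ⟨⟨h, _⟩, h'⟩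
        exact ⟨⟨mem_sieveSupport_of_dvd hk h, h'⟩, h⟩
    rw [← Finset.mul_sum, ← Finset.sum_filter, hset, ← Finset.mul_sum]
    have h3 := sum_moebius_filter_dvd (l := l) (mem_sieveSupport.1 hk).2.1
    have h4 : ∑ d ∈ k.divisors.filter (l ∣ ·), ((ArithmeticFunction.moebius d : ℤ) : ℝ) =
        if k = l then ((ArithmeticFunction.moebius l : ℤ) : ℝ) else 0 := by
      exact_mod_cast h3
    rw [h4]
    split_ifs with hkl
    · subst hkl
      rw [div_mul_eq_mul_div, one_mul, div_mul_eq_mul_div, one_mul, div_div, mul_comm]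
    · simp
  rw [Finset.sum_congr rfl h2, Finset.sum_ite_eq' _ _ _, if_pos hl]

lemma sum_selbergWeight_mul_div_lcm {b R : ℕ} (hR : 1 ≤ R) :
    ∑ d ∈ sieveSupport b R, ∑ k ∈ sieveSupport b R,
      selbergWeight b R d * selbergWeight b R k / (d.lcm k : ℕ) = 1 / sieveMass b R := by
  have hL := sieveMass_pos (b := b) hR
  have hpair : ∀ d ∈ sieveSupport b R, ∀ k ∈ sieveSupport b R,
      selbergWeight b R d * selbergWeight b R k / (d.lcm k : ℕ) =
      ∑ l ∈ sieveSupport b R, (l.totient : ℝ) *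
        ((if l ∣ d then selbergWeight b R d / d else 0) *
          (if l ∣ k then selbergWeight b R k / k else 0)) := by
    intro d hd k hk
    have hd0 : 0 < d := (mem_sieveSupport.1 hd).1.1
    have hk0 : 0 < k := (mem_sieveSupport.1 hk).1.1
    have hd' : (d : ℝ) ≠ 0 := by exact_mod_cast hd0.ne'
    have hk' : (k : ℝ) ≠ 0 := by exact_mod_cast hk0.ne'
    have hset : (sieveSupport b R).filter (fun l => l ∣ d ∧ l ∣ k) = (d.gcd k).divisors := by
      ext l
      simp only [Finset.mem_filter, Nat.mem_divisors, Nat.dvd_gcd_iff]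
      constructor
      · rintro ⟨_, h⟩
        exact ⟨h, (Nat.gcd_pos_of_pos_left k hd0).ne'⟩
      · rintro ⟨h, _⟩
        exact ⟨mem_sieveSupport_of_dvd hd h.1, h⟩
    have h1 : ∀ l ∈ sieveSupport b R, (l.totient : ℝ) *
        ((if l ∣ d then selbergWeight b R d / d else 0) *
          (if l ∣ k then selbergWeight b R k / k else 0)) =
        if l ∣ d ∧ l ∣ k then (l.totient : ℝ) *
          (selbergWeight b R d / d * (selbergWeight b R k / k)) else 0 := by
      intro l _
      by_cases h1 : l ∣ d <;> by_cases h2 : l ∣ k <;> simp [h1, h2]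
    have hgcd : ∑ l ∈ (d.gcd k).divisors, (l.totient : ℝ) = (d.gcd k : ℕ) := by
      exact_mod_cast Nat.sum_totient (d.gcd k)
    have hlcm : ((d.gcd k : ℕ) : ℝ) * (d.lcm k : ℕ) = d * k := by
      exact_mod_cast Nat.gcd_mul_lcm d k
    have hlcm0 : ((d.lcm k : ℕ) : ℝ) ≠ 0 := by
      exact_mod_cast (Nat.lcm_pos hd0 hk0).ne'
    rw [Finset.sum_congr rfl h1, ← Finset.sum_filter, hset, ← Finset.sum_mul, hgcd]
    rw [div_mul_div_comm, ← hlcm]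
    have hg0 : ((d.gcd k : ℕ) : ℝ) ≠ 0 := by
      exact_mod_cast (Nat.gcd_pos_of_pos_left k hd0).ne'
    field_simp
  calc ∑ d ∈ sieveSupport b R, ∑ k ∈ sieveSupport b R,
        selbergWeight b R d * selbergWeight b R k / (d.lcm k : ℕ)
      = ∑ d ∈ sieveSupport b R, ∑ k ∈ sieveSupport b R, ∑ l ∈ sieveSupport b R,
        (l.totient : ℝ) * ((if l ∣ d then selbergWeight b R d / d else 0) *
          (if l ∣ k then selbergWeight b R k / k else 0)) :=
        Finset.sum_congr rfl fun d hd => Finset.sum_congr rfl fun k hk => hpair d hd k hk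
    _ = ∑ l ∈ sieveSupport b R, (l.totient : ℝ) *
        ((∑ d ∈ sieveSupport b R, if l ∣ d then selbergWeight b R d / d else 0) *
          ∑ k ∈ sieveSupport b R, if l ∣ k then selbergWeight b R k / k else 0) := by
        simp_rw [Finset.sum_mul_sum, Finset.mul_sum]
        rw [Finset.sum_comm' (t' := sieveSupport b R) (s' := fun _ => sieveSupport b R) (by tauto)]
        rw [Finset.sum_comm]
        conv_rhs => rw [Finset.sum_comm]
        refine Finset.sum_congr rfl fun d _ => ?_
        rw [Finset.sum_comm]
    _ = ∑ l ∈ sieveSupport b R, 1 / sieveMass b R ^ 2 * (1 / (l.totient : ℝ)) := by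
        refine Finset.sum_congr rfl fun l hl => ?_
        rw [← Finset.sum_filter, sum_selbergWeight_div hl]
        have hφ : (l.totient : ℝ) ≠ 0 := by
          exact_mod_cast (Nat.totient_pos.2 (mem_sieveSupport.1 hl).1.1).ne'
        have hμ : ((ArithmeticFunction.moebius l : ℤ) : ℝ) ^ 2 = 1 := by
          exact_mod_cast ArithmeticFunction.moebius_sq_eq_one_of_squarefree
            (mem_sieveSupport.1 hl).2.1
        field_simp
        rw [hμ]
    _ = 1 / sieveMass b R := by
        rw [← Finset.mul_sum, ← sieveMass]
        field_simp

/-- Selberg's sieve: the sum of `1 / n` over the integers `n ∈ (N, M]` in a residue class modulo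
`b` all of whose prime factors exceed `R`. -/
lemma sum_one_div_rough_le {b R N M : ℕ} (c : ℕ) (hb : 0 < b) (hR : 1 < R) (hN : 0 < N)
    (hNM : N ≤ M) (D : Finset ℕ)
    (hD : ∀ n ∈ D, n ∈ Finset.Ioc N M ∧ n ≡ c [MOD b] ∧ ∀ p : ℕ, p.Prime → p ∣ n → R < p) :
    ∑ n ∈ D, (1 : ℝ) / n ≤ Real.log (M / N) / (b.totient * Real.log R) + (R : ℝ) ^ 4 / N := by
  set E := sieveSupport b R with hE
  set w := selbergWeight b R with hw
  have hR1 : 1 ≤ R := hR.le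
  have hN' : (0 : ℝ) < N := by exact_mod_cast hN
  have hb' : (0 : ℝ) < b := by exact_mod_cast hb
  have hH : 0 ≤ Real.log (M / N) := by
    apply Real.log_nonneg
    rw [le_div_iff₀ hN', one_mul]
    exact_mod_cast hNM
  set A := (Finset.Ioc N M).filter (· ≡ c [MOD b]) with hA
  have hone : ∀ n ∈ D, ∑ d ∈ E, (if d ∣ n then w d else 0) = 1 := by
    intro n hn
    have hset : E.filter (· ∣ n) = {1} := by
      ext d
      rw [Finset.mem_filter, Finset.mem_singleton]
      constructor
      · rintro ⟨hdE, hdn⟩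
        by_contra hd1
        obtain ⟨p, hp, hpd⟩ := Nat.exists_prime_and_dvd hd1
        have h1 := (hD n hn).2.2 p hp (hpd.trans hdn)
        have h2 := mem_sieveSupport.1 hdE
        have h3 := Nat.le_of_dvd h2.1.1 hpd
        lia
      · rintro rfl
        exact ⟨one_mem_sieveSupport hR1, one_dvd n⟩
    rw [← Finset.sum_filter, hset, Finset.sum_singleton, hw, selbergWeight_one hR1]
  have hinner : ∀ d ∈ E, ∀ k ∈ E,
      |∑ n ∈ A, (if d ∣ n ∧ k ∣ n then (1 : ℝ) / n else 0) -
        Real.log (M / N) / b * (1 / (d.lcm k : ℕ))| ≤ 1 / N := by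
    intro d hd k hk
    rw [hE, mem_sieveSupport] at hd hk
    have hpos : 0 < d.lcm k := Nat.lcm_pos hd.1.1 hk.1.1
    have hcop : b.Coprime (d.lcm k) :=
      (Nat.Coprime.coprime_dvd_left (Nat.lcm_dvd_mul d k) (hd.2.2.mul_left hk.2.2)).symm
    obtain ⟨c', hc1, hc2⟩ := Nat.chineseRemainder hcop c 0
    have hset : A.filter (fun n => d ∣ n ∧ k ∣ n) =
        (Finset.Ioc N M).filter (· ≡ c' [MOD b * d.lcm k]) := by
      ext n
      rw [hA, Finset.mem_filter, Finset.mem_filter, Finset.mem_filter, and_assoc]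
      refine and_congr_right fun _ => ?_
      rw [← Nat.lcm_dvd_iff, ← Nat.modEq_zero_iff_dvd, ← Nat.modEq_and_modEq_iff_modEq_mul hcop]
      constructor
      · rintro ⟨h1, h2⟩
        exact ⟨h1.trans hc1.symm, h2.trans hc2.symm⟩
      · rintro ⟨h1, h2⟩
        exact ⟨h1.trans hc1, h2.trans hc2⟩
    have h := abs_sum_filter_modEq_sub_le (Nat.mul_pos hb hpos) c' hN hNM
    rw [← Finset.sum_filter, hset]
    convert h using 3
    push_cast
    rw [div_mul_div_comm, mul_one]
  have hexp : ∑ n ∈ A, (1 : ℝ) / n * (∑ d ∈ E, if d ∣ n then w d else 0) ^ 2 =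
      ∑ d ∈ E, ∑ k ∈ E, w d * w k * ∑ n ∈ A, (if d ∣ n ∧ k ∣ n then (1 : ℝ) / n else 0) := by
    simp_rw [sq, Finset.sum_mul_sum, Finset.mul_sum]
    rw [Finset.sum_comm]
    refine Finset.sum_congr rfl fun d _ => ?_
    rw [Finset.sum_comm]
    refine Finset.sum_congr rfl fun k _ => Finset.sum_congr rfl fun n _ => ?_
    by_cases h1 : d ∣ n <;> by_cases h2 : k ∣ n <;> simp [h1, h2]
    ring
  have hweights : ∑ d ∈ E, |w d| ≤ (R : ℝ) ^ 2 := by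
    calc ∑ d ∈ E, |w d| ≤ ∑ d ∈ E, (R : ℝ) := by
          refine Finset.sum_le_sum fun d hd => (abs_selbergWeight_le hR1 d).trans ?_
          exact_mod_cast (mem_sieveSupport.1 hd).1.2
      _ = E.card * (R : ℝ) := by rw [Finset.sum_const, nsmul_eq_mul]
      _ ≤ R * R := by
          gcongr
          have h1 := Finset.card_le_card (Finset.filter_subset
            (fun l => Squarefree l ∧ l.Coprime b) (Finset.Icc 1 R))
          rwa [Nat.card_Icc, Nat.add_sub_cancel] at h1
      _ = (R : ℝ) ^ 2 := by ring
  calc ∑ n ∈ D, (1 : ℝ) / n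
      = ∑ n ∈ D, (1 : ℝ) / n * (∑ d ∈ E, if d ∣ n then w d else 0) ^ 2 := by
        refine Finset.sum_congr rfl fun n hn => ?_
        rw [hone n hn]
        ring
    _ ≤ ∑ n ∈ A, (1 : ℝ) / n * (∑ d ∈ E, if d ∣ n then w d else 0) ^ 2 := by
        refine Finset.sum_le_sum_of_subset_of_nonneg (fun n hn => ?_) fun n _ _ => by positivity
        exact Finset.mem_filter.2 ⟨(hD n hn).1, (hD n hn).2.1⟩
    _ ≤ ∑ d ∈ E, ∑ k ∈ E, (Real.log (M / N) / b * (w d * w k / (d.lcm k : ℕ)) +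
          |w d| * |w k| * (1 / N)) := by
        rw [hexp]
        refine Finset.sum_le_sum fun d hd => Finset.sum_le_sum fun k hk => ?_
        have h1 := hinner d hd k hk
        set s := ∑ n ∈ A, (if d ∣ n ∧ k ∣ n then (1 : ℝ) / n else 0)
        have h2 : w d * w k * (s - Real.log (M / N) / b * (1 / (d.lcm k : ℕ))) ≤
            |w d| * |w k| * (1 / N) := by
          refine (le_abs_self _).trans ?_
          rw [abs_mul, abs_mul]
          gcongr
        have h3 : Real.log (M / N) / b * (w d * w k / (d.lcm k : ℕ)) =
            w d * w k * (Real.log (M / N) / b * (1 / (d.lcm k : ℕ))) := by ring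
        rw [h3]
        linarith
    _ = Real.log (M / N) / b * (1 / sieveMass b R) + (∑ d ∈ E, |w d|) ^ 2 * (1 / N) := by
        rw [← sum_selbergWeight_mul_div_lcm hR1, sq, Finset.sum_mul_sum]
        simp_rw [Finset.sum_add_distrib, Finset.mul_sum, Finset.sum_mul]
        rfl
    _ ≤ _ := by
        have hlogR : 0 < Real.log R := Real.log_pos (by exact_mod_cast hR)
        have hφ : (0 : ℝ) < b.totient := by exact_mod_cast Nat.totient_pos.2 hb
        have hL := sieveMass_pos (b := b) hR1
        have hmass := log_le_mul_sieveMass hb R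
        have h1 : (b.totient : ℝ) * Real.log R ≤ b * sieveMass b R := by
          rw [div_mul_eq_mul_div, le_div_iff₀ hφ] at hmass
          linarith
        have h2 : Real.log (M / N) / b * (1 / sieveMass b R) ≤
            Real.log (M / N) / (b.totient * Real.log R) := by
          rw [div_mul_div_comm, mul_one]
          exact div_le_div_of_nonneg_left hH (by positivity) h1
        have h3 : (∑ d ∈ E, |w d|) ^ 2 * (1 / (N : ℝ)) ≤ (R : ℝ) ^ 4 / N := by
          have h0 : 0 ≤ ∑ d ∈ E, |w d| := Finset.sum_nonneg fun d _ => abs_nonneg _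
          rw [mul_one_div]
          gcongr
          calc (∑ d ∈ E, |w d|) ^ 2 ≤ ((R : ℝ) ^ 2) ^ 2 := by gcongr
            _ = (R : ℝ) ^ 4 := by ring
        linarith

/-! ### Exponential sums over smooth numbers -/

lemma sum_filter_dvd_Icc {d : ℕ} (hd : 0 < d) (Z : ℕ) (g : ℕ → ℂ) :
    ∑ n ∈ (Finset.Icc 1 Z).filter (d ∣ ·), g n = ∑ m ∈ Finset.Icc 1 (Z / d), g (d * m) := by
  have hset : (Finset.Icc 1 Z).filter (d ∣ ·) = (Finset.Icc 1 (Z / d)).image (d * ·) := by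
    ext n
    simp only [Finset.mem_filter, Finset.mem_Icc, Finset.mem_image]
    constructor
    · rintro ⟨⟨h1, h2⟩, m, rfl⟩
      refine ⟨m, ⟨Nat.pos_of_mul_pos_left h1, ?_⟩, rfl⟩
      rw [Nat.le_div_iff_mul_le hd]
      lia
    · rintro ⟨m, ⟨h1, h2⟩, rfl⟩
      rw [Nat.le_div_iff_mul_le hd] at h2
      exact ⟨⟨Nat.mul_pos hd h1, by lia⟩, dvd_mul_right d m⟩
  rw [hset, Finset.sum_image fun x _ z _ h => Nat.eq_of_mul_eq_mul_left hd h]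

lemma sum_dvd_pow_div {d : ℕ} (hd : 0 < d) (Z : ℕ) (ζ : ℂ) :
    ∑ n ∈ (Finset.Icc 1 Z).filter (d ∣ ·), ζ ^ n / n =
      1 / (d : ℂ) * ∑ m ∈ Finset.Icc 1 (Z / d), (ζ ^ d) ^ m / m := by
  rw [sum_filter_dvd_Icc hd Z fun n => ζ ^ n / n, Finset.mul_sum]
  refine Finset.sum_congr rfl fun m _ => ?_
  rw [pow_mul, div_mul_div_comm, one_mul]
  push_cast
  rfl

/-- The positive integers up to `Z` all of whose prime factors exceed `y`. -/
noncomputable def roughUpTo (y : ℝ) (Z : ℕ) : Finset ℕ :=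
  (Finset.Icc 1 Z).filter fun n => ∀ p : ℕ, p.Prime → p ∣ n → y < (p : ℝ)

lemma mem_roughUpTo {y : ℝ} {Z n : ℕ} :
    n ∈ roughUpTo y Z ↔ (1 ≤ n ∧ n ≤ Z) ∧ ∀ p : ℕ, p.Prime → p ∣ n → y < (p : ℝ) := by
  rw [roughUpTo, Finset.mem_filter, Finset.mem_Icc]

lemma lt_of_mem_roughUpTo {y : ℝ} {Z n : ℕ} (hn : n ∈ roughUpTo y Z) (h1 : n ≠ 1) :
    y < (n : ℝ) := by
  rw [mem_roughUpTo] at hn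
  obtain ⟨p, hp, hpn⟩ := Nat.exists_prime_and_dvd h1
  refine (hn.2 p hp hpn).trans_le ?_
  exact_mod_cast Nat.le_of_dvd hn.1.1 hpn

/-- Möbius inversion: the smooth sum is controlled by complete sums dilated by rough integers. -/
lemma norm_sum_smooth_le_sum_rough (y : ℝ) (Z : ℕ) (ζ : ℂ) :
    ‖∑ n ∈ smoothUpTo y Z, ζ ^ n / n‖ ≤
      ∑ d ∈ roughUpTo y Z, 1 / (d : ℝ) * ‖∑ m ∈ Finset.Icc 1 (Z / d), (ζ ^ d) ^ m / m‖ := by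
  set Q := (Finset.Icc 1 Z).filter (fun p : ℕ => p.Prime ∧ y < (p : ℝ)) with hQ
  set P := ∏ p ∈ Q, p with hP
  have hQprime : ∀ p ∈ Q, p.Prime := fun p hp => (Finset.mem_filter.1 hp).2.1
  have hP0 : P ≠ 0 := Finset.prod_ne_zero_iff.2 fun p hp => (hQprime p hp).ne_zero
  have hind : ∀ n ∈ Finset.Icc 1 Z,
      ∑ d ∈ P.divisors.filter (· ∣ n), ((ArithmeticFunction.moebius d : ℤ) : ℂ) =
        if ∀ p : ℕ, p.Prime → p ∣ n → (p : ℝ) ≤ y then 1 else 0 := by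
    intro n hn
    rw [Finset.mem_Icc] at hn
    have hset : P.divisors.filter (· ∣ n) = (P.gcd n).divisors := by
      ext d
      simp only [Finset.mem_filter, Nat.mem_divisors, Nat.dvd_gcd_iff]
      have : P.gcd n ≠ 0 := (Nat.gcd_pos_of_pos_right P hn.1).ne'
      tauto
    have h1 : ∑ d ∈ (P.gcd n).divisors, ArithmeticFunction.moebius d =
        if P.gcd n = 1 then 1 else 0 := by
      rw [← ArithmeticFunction.coe_mul_zeta_apply, ArithmeticFunction.moebius_mul_coe_zeta,
        ArithmeticFunction.one_apply]
    have h2 : P.gcd n = 1 ↔ ∀ p : ℕ, p.Prime → p ∣ n → (p : ℝ) ≤ y := by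
      constructor
      · intro hg p hp hpn
        by_contra hlt
        push Not at hlt
        have hpQ : p ∈ Q := by
          rw [hQ, Finset.mem_filter, Finset.mem_Icc]
          exact ⟨⟨hp.pos, (Nat.le_of_dvd hn.1 hpn).trans hn.2⟩, hp, hlt⟩
        have hpP : p ∣ P := Finset.dvd_prod_of_mem (fun p : ℕ => p) hpQ
        have := Nat.dvd_gcd hpP hpn
        rw [hg] at this
        exact hp.one_lt.ne' (Nat.dvd_one.1 this)
      · intro h
        refine Nat.Coprime.prod_left fun p hp => ?_
        rw [(hQprime p hp).coprime_iff_not_dvd]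
        intro hpn
        exact absurd (h p (hQprime p hp) hpn) (not_le.2 (Finset.mem_filter.1 hp).2.2)
    rw [hset]
    have h3 : ∑ d ∈ (P.gcd n).divisors, ((ArithmeticFunction.moebius d : ℤ) : ℂ) =
        if P.gcd n = 1 then 1 else 0 := by exact_mod_cast h1
    rw [h3]
    simp only [h2]
  have hexp : ∑ n ∈ smoothUpTo y Z, ζ ^ n / n =
      ∑ d ∈ P.divisors, ((ArithmeticFunction.moebius d : ℤ) : ℂ) *
        (1 / (d : ℂ) * ∑ m ∈ Finset.Icc 1 (Z / d), (ζ ^ d) ^ m / m) := by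
    calc ∑ n ∈ smoothUpTo y Z, ζ ^ n / n
        = ∑ n ∈ Finset.Icc 1 Z, ∑ d ∈ P.divisors,
            if d ∣ n then ((ArithmeticFunction.moebius d : ℤ) : ℂ) * (ζ ^ n / n) else 0 := by
          rw [smoothUpTo, Finset.sum_filter]
          refine Finset.sum_congr rfl fun n hn => ?_
          rw [← Finset.sum_filter, ← Finset.sum_mul, hind n hn]
          split_ifs <;> simp
      _ = _ := by
          rw [Finset.sum_comm]
          refine Finset.sum_congr rfl fun d hd => ?_
          rw [← sum_dvd_pow_div (Nat.pos_of_mem_divisors hd), ← Finset.sum_filter,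
            Finset.mul_sum]
  rw [hexp]
  refine (norm_sum_le _ _).trans ?_
  have hterm : ∀ d ∈ P.divisors, ‖((ArithmeticFunction.moebius d : ℤ) : ℂ) *
        (1 / (d : ℂ) * ∑ m ∈ Finset.Icc 1 (Z / d), (ζ ^ d) ^ m / m)‖ ≤
      if d ∈ roughUpTo y Z then
        1 / (d : ℝ) * ‖∑ m ∈ Finset.Icc 1 (Z / d), (ζ ^ d) ^ m / m‖ else 0 := by
    intro d hd
    have hd0 : 0 < d := Nat.pos_of_mem_divisors hd
    have hdP : d ∣ P := Nat.dvd_of_mem_divisors hd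
    split_ifs with hr
    · have hμ : ‖((ArithmeticFunction.moebius d : ℤ) : ℂ)‖ ≤ 1 := by
        rw [Complex.norm_intCast]
        exact_mod_cast ArithmeticFunction.abs_moebius_le_one
      rw [norm_mul, norm_mul, norm_div, norm_one, Complex.norm_natCast]
      exact mul_le_of_le_one_left (by positivity) hμ
    · have hlt : Z < d := by
        by_contra hle
        push Not at hle
        refine hr (mem_roughUpTo.2 ⟨⟨hd0, hle⟩, fun p hp hpd => ?_⟩)
        obtain ⟨r, hrQ, hpr⟩ := (hp.prime.dvd_finsetProd_iff _).1 (hpd.trans hdP)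
        rw [(Nat.prime_dvd_prime_iff_eq hp (hQprime r hrQ)).1 hpr]
        exact (Finset.mem_filter.1 hrQ).2.2
      rw [Nat.div_eq_of_lt hlt]
      simp
  refine (Finset.sum_le_sum hterm).trans ?_
  rw [← Finset.sum_filter]
  refine Finset.sum_le_sum_of_subset_of_nonneg (fun d hd => (Finset.mem_filter.1 hd).2)
    fun d _ _ => by positivity

/-- Exponential sums over smooth numbers in terms of the sieve parameters. -/
lemma norm_sum_smooth_le_of_sieve {y : ℝ} {b R Z M : ℕ} {ζ : ℂ} (hy : 1 ≤ y) (hb : 1 < b)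
    (hby : (b : ℝ) ≤ y) (hζ : IsPrimitiveRoot ζ b) (hR : 1 < R) (hRy : (R : ℝ) ≤ y)
    (hZM : Z ≤ M) (hyM : ⌊y⌋₊ ≤ M) :
    ‖∑ n ∈ smoothUpTo y Z, ζ ^ n / n‖ ≤ Real.log b + 2 +
      (Real.log M / (b.totient * Real.log R) + (R : ℝ) ^ 4 / ⌊y⌋₊) * (b.totient * 3) := by
  set N := ⌊y⌋₊ with hNdef
  have hN : 0 < N := Nat.floor_pos.2 hy
  have hb0 : 0 < b := by lia
  have hN' : (1 : ℝ) ≤ N := by exact_mod_cast hN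
  have hM' : (0 : ℝ) < M := by exact_mod_cast hN.trans_le hyM
  set B := Real.log M / (b.totient * Real.log R) + (R : ℝ) ^ 4 / N with hB
  have hlogR : 0 < Real.log R := Real.log_pos (by exact_mod_cast hR)
  have hφ : (0 : ℝ) < b.totient := by exact_mod_cast Nat.totient_pos.2 hb0
  have hB0 : 0 ≤ B := by
    have := Real.log_natCast_nonneg M
    positivity
  have hprim : ∀ d ∈ roughUpTo y Z, IsPrimitiveRoot (ζ ^ d) b := by
    intro d hd
    refine hζ.pow_of_coprime d ?_
    refine Nat.Coprime.symm (Nat.coprime_of_dvd fun p hp hpb hpd => ?_)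
    have h1 := (mem_roughUpTo.1 hd).2 p hp hpd
    have h2 : (p : ℝ) ≤ b := by exact_mod_cast Nat.le_of_dvd hb0 hpb
    linarith
  have hbound : ∀ d ∈ roughUpTo y Z, ‖∑ m ∈ Finset.Icc 1 (Z / d), (ζ ^ d) ^ m / m‖ ≤
      Real.log (2 / ‖1 - ζ ^ d‖) + 2 := fun d hd =>
    norm_sum_pow_div_le ((hprim d hd).norm'_eq_one hb0.ne') ((hprim d hd).ne_one hb) _
  have hG0 : ∀ η ∈ primitiveRoots b ℂ, 0 ≤ Real.log (2 / ‖1 - η‖) + 2 := by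
    intro η hη
    have h := isPrimitiveRoot_of_mem_primitiveRoots hη
    exact (norm_nonneg _).trans
      (norm_sum_pow_div_le (h.norm'_eq_one hb0.ne') (h.ne_one hb) 0)
  have hfiber : ∀ η ∈ primitiveRoots b ℂ,
      ∑ d ∈ ((roughUpTo y Z).filter (· ≠ 1)).filter (fun d => ζ ^ d = η), (1 : ℝ) / d ≤ B := by
    intro η _
    set D := ((roughUpTo y Z).filter (· ≠ 1)).filter (fun d => ζ ^ d = η) with hD
    rcases D.eq_empty_or_nonempty with hemp | ⟨c, hc⟩
    · rw [hemp, Finset.sum_empty]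
      exact hB0
    · refine (sum_one_div_rough_le (R := R) (M := M) c hb0 hR hN hyM D ?_).trans ?_
      · intro n hn
        rw [hD, Finset.mem_filter, Finset.mem_filter] at hn hc
        have hlt := lt_of_mem_roughUpTo hn.1.1 hn.1.2
        have hn' := mem_roughUpTo.1 hn.1.1
        refine ⟨Finset.mem_Ioc.2 ⟨?_, hn'.1.2.trans hZM⟩, ?_, fun p hp hpn => ?_⟩
        · exact (Nat.floor_lt (by linarith)).2 hlt
        · refine hζ.pow_inj (Nat.mod_lt _ (by lia)) (Nat.mod_lt _ (by lia)) ?_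
          rw [← pow_eq_pow_mod _ hζ.pow_eq_one, ← pow_eq_pow_mod _ hζ.pow_eq_one]
          exact hn.2.trans hc.2.symm
        · exact_mod_cast hRy.trans_lt (hn'.2 p hp hpn)
      · rw [hB]
        gcongr
        exact div_le_self hM'.le hN'
  have hmain : ∑ d ∈ (roughUpTo y Z).filter (· ≠ 1),
      1 / (d : ℝ) * ‖∑ m ∈ Finset.Icc 1 (Z / d), (ζ ^ d) ^ m / m‖ ≤ B * (b.totient * 3) := by
    calc ∑ d ∈ (roughUpTo y Z).filter (· ≠ 1),
          1 / (d : ℝ) * ‖∑ m ∈ Finset.Icc 1 (Z / d), (ζ ^ d) ^ m / m‖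
        ≤ ∑ d ∈ (roughUpTo y Z).filter (· ≠ 1),
          1 / (d : ℝ) * (Real.log (2 / ‖1 - ζ ^ d‖) + 2) := by
          refine Finset.sum_le_sum fun d hd => ?_
          gcongr
          exact hbound d (Finset.mem_filter.1 hd).1
      _ = ∑ η ∈ primitiveRoots b ℂ,
          ∑ d ∈ ((roughUpTo y Z).filter (· ≠ 1)).filter (fun d => ζ ^ d = η),
            1 / (d : ℝ) * (Real.log (2 / ‖1 - ζ ^ d‖) + 2) := by
          refine (Finset.sum_fiberwise_of_maps_to (fun d hd => ?_) _).symm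
          rw [mem_primitiveRoots hb0]
          exact hprim d (Finset.mem_filter.1 hd).1
      _ = ∑ η ∈ primitiveRoots b ℂ,
          (∑ d ∈ ((roughUpTo y Z).filter (· ≠ 1)).filter (fun d => ζ ^ d = η),
            1 / (d : ℝ)) * (Real.log (2 / ‖1 - η‖) + 2) := by
          refine Finset.sum_congr rfl fun η _ => ?_
          rw [Finset.sum_mul]
          refine Finset.sum_congr rfl fun d hd => ?_
          rw [(Finset.mem_filter.1 hd).2]
      _ ≤ ∑ η ∈ primitiveRoots b ℂ, B * (Real.log (2 / ‖1 - η‖) + 2) :=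
          Finset.sum_le_sum fun η hη => mul_le_mul_of_nonneg_right (hfiber η hη) (hG0 η hη)
      _ ≤ B * (b.totient * 3) := by
          rw [← Finset.mul_sum]
          gcongr
          rw [Finset.sum_add_distrib, Finset.sum_const, nsmul_eq_mul, hζ.card_primitiveRoots]
          have h1 := sum_primitiveRoots_log_le hb
          nlinarith [Real.log_two_lt_d9]
  have hfirst : ∑ d ∈ (roughUpTo y Z).filter (¬ · ≠ 1),
      1 / (d : ℝ) * ‖∑ m ∈ Finset.Icc 1 (Z / d), (ζ ^ d) ^ m / m‖ ≤ Real.log b + 2 := by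
    have hne1 : ζ ≠ 1 := hζ.ne_one hb
    have hδ : 0 < ‖1 - ζ‖ := norm_pos_iff.2 (sub_ne_zero.2 hne1.symm)
    have hlog : Real.log (2 / ‖1 - ζ‖) ≤ Real.log b :=
      Real.log_le_log (by positivity) (two_div_norm_one_sub_le hb hζ)
    have hsub : (roughUpTo y Z).filter (¬ · ≠ 1) ⊆ {1} := by
      intro d hd
      have := (Finset.mem_filter.1 hd).2
      push Not at this
      rw [Finset.mem_singleton, this]
    refine (Finset.sum_le_sum_of_subset_of_nonneg hsub fun d _ _ => by positivity).trans ?_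
    rw [Finset.sum_singleton, Nat.div_one, pow_one, Nat.cast_one, div_one, one_mul]
    have := norm_sum_pow_div_le (hζ.norm'_eq_one hb0.ne') hne1 Z
    linarith
  refine (norm_sum_smooth_le_sum_rough y Z ζ).trans ?_
  rw [← Finset.sum_filter_add_sum_filter_not _ (fun d : ℕ => d ≠ 1)]
  linarith

lemma exists_forall_sieve_parameters :
    ∃ Y : ℝ, 3 ≤ Y ∧ ∀ y : ℝ, Y ≤ y → 1 ≤ Real.log (Real.log y) ∧ 2 ≤ Real.log y ∧
      2 * Real.log y ^ (100 : ℕ) ≤ √y ∧ 2 ≤ y ^ (1 / 16 : ℝ) := by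
  have h1 : ∀ᶠ y : ℝ in Filter.atTop, 1 ≤ Real.log (Real.log y) :=
    (Real.tendsto_log_atTop.comp Real.tendsto_log_atTop).eventually_ge_atTop 1
  have h2 : ∀ᶠ y : ℝ in Filter.atTop, 2 ≤ Real.log y :=
    Real.tendsto_log_atTop.eventually_ge_atTop 2
  have h3 : ∀ᶠ y : ℝ in Filter.atTop, ‖Real.log y ^ 200‖ ≤ 1 / 4 * ‖y‖ :=
    (Real.isLittleO_pow_log_id_atTop (n := 200)).def (by norm_num)
  have h4 : ∀ᶠ y : ℝ in Filter.atTop, 2 ≤ y ^ (1 / 16 : ℝ) :=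
    (tendsto_rpow_atTop (by norm_num)).eventually_ge_atTop 2
  obtain ⟨Y, hY⟩ := Filter.eventually_atTop.1 (h1.and (h2.and (h3.and h4)))
  refine ⟨max 3 Y, le_max_left _ _, fun y hy => ?_⟩
  obtain ⟨a1, a2, a3, a4⟩ := hY y ((le_max_right _ _).trans hy)
  refine ⟨a1, a2, ?_, a4⟩
  have hy0 : 0 ≤ y := le_trans (by norm_num) ((le_max_left _ _).trans hy)
  rw [Real.norm_of_nonneg hy0, Real.norm_of_nonneg (by positivity)] at a3
  refine Real.le_sqrt_of_sq_le ?_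
  calc (2 * Real.log y ^ 100) ^ 2 = 4 * Real.log y ^ 200 := by ring
    _ ≤ y := by linarith

lemma norm_sum_smooth_le_of_le_rpow {y u : ℝ} {b Z : ℕ} {ζ : ℂ} (hy : 3 ≤ y)
    (hly : 2 ≤ Real.log y)
    (hsqrt : 2 * Real.log y ^ (100 : ℕ) ≤ √y) (hroot : 2 ≤ y ^ (1 / 16 : ℝ)) (hu : 1 ≤ u)
    (hb : 1 < b) (hby : (b : ℝ) ≤ Real.log y ^ (100 : ℕ)) (hζ : IsPrimitiveRoot ζ b)
    (hZ : (Z : ℝ) ≤ y ^ u) :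
    ‖∑ n ∈ smoothUpTo y Z, ζ ^ n / n‖ ≤ 100 * Real.log (Real.log y) + 5 + 48 * u := by
  have hy0 : 0 < y := by linarith
  set R := ⌊y ^ (1 / 8 : ℝ)⌋₊ with hR
  have hsq : y ^ (1 / 8 : ℝ) = y ^ (1 / 16 : ℝ) * y ^ (1 / 16 : ℝ) := by
    rw [← Real.rpow_add hy0]; norm_num
  have hRlow : y ^ (1 / 16 : ℝ) ≤ R := by
    have := Nat.lt_floor_add_one (y ^ (1 / 8 : ℝ))
    rw [← hR] at this
    nlinarith
  have hRup : (R : ℝ) ≤ y ^ (1 / 8 : ℝ) := Nat.floor_le (by positivity)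
  have hR1 : 1 < R := by
    have : (2 : ℝ) ≤ R := hroot.trans hRlow
    exact_mod_cast this
  have hRy : (R : ℝ) ≤ y := hRup.trans (by
    simpa using Real.rpow_le_rpow_of_exponent_le (x := y) (by linarith)
      (show (1 / 8 : ℝ) ≤ 1 by norm_num))
  have hlogR : Real.log y / 16 ≤ Real.log R := by
    have := Real.log_le_log (by positivity) hRlow
    rw [Real.log_rpow hy0] at this
    linarith
  have hR4 : (R : ℝ) ^ 4 ≤ √y := by
    calc (R : ℝ) ^ 4 ≤ (y ^ (1 / 8 : ℝ)) ^ 4 := by gcongr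
      _ = √y := by
        rw [← Real.rpow_natCast, ← Real.rpow_mul hy0.le, Real.sqrt_eq_rpow]; norm_num
  have hsy : √y * √y = y := Real.mul_self_sqrt hy0.le
  have hb1 : (1 : ℝ) < b := by exact_mod_cast hb
  have hbs : 2 * (b : ℝ) ≤ √y := by linarith
  have hbley : (b : ℝ) ≤ y := by nlinarith
  have hfl : y / 2 ≤ (⌊y⌋₊ : ℝ) := by
    have := Nat.lt_floor_add_one y
    linarith
  have hφ0 : 0 < (b.totient : ℝ) := by
    exact_mod_cast Nat.totient_pos.2 (by lia)
  have hφb : (b.totient : ℝ) ≤ b := by exact_mod_cast Nat.totient_le b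
  have hMcast : ((max Z ⌊y⌋₊ : ℕ) : ℝ) ≤ y ^ u := by
    rw [Nat.cast_max]
    refine max_le hZ ((Nat.floor_le hy0.le).trans ?_)
    simpa using Real.rpow_le_rpow_of_exponent_le (x := y) (by linarith) hu
  have hlogM : Real.log ((max Z ⌊y⌋₊ : ℕ) : ℝ) ≤ u * Real.log y := by
    rw [← Real.log_rpow hy0]
    refine Real.log_le_log ?_ hMcast
    have : (0 : ℝ) < (⌊y⌋₊ : ℝ) := by linarith
    refine this.trans_le ?_
    exact_mod_cast le_max_right _ _
  have hlogb : Real.log b ≤ 100 * Real.log (Real.log y) := by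
    have := Real.log_le_log (by linarith) hby
    rwa [Real.log_pow, Nat.cast_ofNat] at this
  refine (norm_sum_smooth_le_of_sieve (by linarith) hb hbley hζ hR1 hRy
    (le_max_left Z ⌊y⌋₊) (le_max_right Z ⌊y⌋₊)).trans ?_
  have hmain : Real.log ((max Z ⌊y⌋₊ : ℕ) : ℝ) / (b.totient * Real.log R) * (b.totient * 3) ≤
      48 * u := by
    have hRpos : 0 < Real.log R := by linarith
    have : Real.log ((max Z ⌊y⌋₊ : ℕ) : ℝ) / (b.totient * Real.log R) * (b.totient * 3) =
        3 * Real.log ((max Z ⌊y⌋₊ : ℕ) : ℝ) / Real.log R := by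
      field_simp
    rw [this, div_le_iff₀ hRpos]
    nlinarith
  have herr : (R : ℝ) ^ 4 / ⌊y⌋₊ * (b.totient * 3) ≤ 3 := by
    have hfpos : (0 : ℝ) < (⌊y⌋₊ : ℝ) := by linarith
    rw [div_mul_eq_mul_div, div_le_iff₀ hfpos]
    have : (R : ℝ) ^ 4 * b.totient ≤ √y * (√y / 2) := by
      gcongr
      linarith
    nlinarith
  rw [add_mul]
  linarith

lemma exists_norm_sum_smooth_le :
    ∃ C Y : ℝ, 0 < C ∧ 3 ≤ Y ∧ ∀ (y : ℝ) (Z b : ℕ) (ζ : ℂ), Y ≤ y → 1 < b →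
      (b : ℝ) ≤ Real.log y ^ (100 : ℕ) → IsPrimitiveRoot ζ b →
      1 ≤ Real.log (Real.log y) ∧ (b : ℝ) ≤ y ∧
        ‖∑ n ∈ smoothUpTo y Z, ζ ^ n / n‖ ≤ C * Real.log (Real.log y) := by
  obtain ⟨Y, hY3, hY⟩ := exists_forall_sieve_parameters
  refine ⟨2409 + Real.exp 108, Y, by positivity, hY3, fun y Z b ζ hy hb hby hζ => ?_⟩
  obtain ⟨hll, hly, hsqrt, hroot⟩ := hY y hy
  have hy3 : 3 ≤ y := hY3.trans hy
  have hy0 : 0 < y := by linarith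
  refine ⟨hll, ?_, ?_⟩
  · have : √y * √y = y := Real.mul_self_sqrt hy0.le
    have hb1 : (1 : ℝ) < b := by exact_mod_cast hb
    nlinarith
  set u := 48 * Real.log (Real.log y) with hu
  set W := ⌊y ^ u⌋₊ with hW
  have hhead := norm_sum_smooth_le_of_le_rpow (Z := min Z W) hy3 hly hsqrt hroot
    (by linarith : 1 ≤ u) hb hby hζ
    ((Nat.cast_le.2 (min_le_right Z W)).trans (Nat.floor_le (by positivity)))
  have htail : ‖∑ n ∈ (smoothUpTo y Z).filter (fun n : ℕ => ¬ n ≤ W), ζ ^ n / n‖ ≤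
      Real.exp 108 := by
    calc ‖∑ n ∈ (smoothUpTo y Z).filter (fun n : ℕ => ¬ n ≤ W), ζ ^ n / n‖
        ≤ ∑ n ∈ (smoothUpTo y Z).filter (fun n : ℕ => ¬ n ≤ W), (1 : ℝ) / n := by
          refine norm_sum_le_of_le _ fun n _ => ?_
          rw [norm_div, norm_pow, hζ.norm'_eq_one (by lia)]
          simp
      _ ≤ ∑ n ∈ (smoothUpTo y Z).filter (fun n : ℕ => y ^ u ≤ (n : ℝ)), (1 : ℝ) / n := by
          refine Finset.sum_le_sum_of_subset_of_nonneg (fun n hn => ?_) fun _ _ _ => by positivity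
          rw [Finset.mem_filter] at hn ⊢
          exact ⟨hn.1, ((Nat.floor_lt (by positivity)).1 (not_le.1 hn.2)).le⟩
      _ ≤ Real.exp (-u) * Real.exp (12 * (4 * Real.log (Real.log y) + 9)) :=
          sum_smooth_tail_le hy3 hly Z
      _ = Real.exp 108 := by
          rw [← Real.exp_add, hu]
          ring_nf
  have hfilter : (smoothUpTo y Z).filter (fun n : ℕ => n ≤ W) = smoothUpTo y (min Z W) := by
    ext n
    simp only [Finset.mem_filter, mem_smoothUpTo, le_min_iff]
    tauto
  rw [← Finset.sum_filter_add_sum_filter_not _ (fun n : ℕ => n ≤ W), hfilter]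
  refine (norm_add_le _ _).trans ((add_le_add hhead htail).trans ?_)
  nlinarith [Real.exp_pos 108]

lemma sum_smooth_coprime_pow_div {y : ℝ} {q : ℕ} (hq : q.Prime) (hqy : (q : ℝ) ≤ y) (Z : ℕ)
    (ζ : ℂ) :
    ∑ n ∈ (smoothUpTo y Z).filter (fun n : ℕ => n.Coprime q), ζ ^ n / n =
      ∑ n ∈ smoothUpTo y Z, ζ ^ n / n -
        (1 / q : ℂ) * ∑ n ∈ smoothUpTo y (Z / q), (ζ ^ q) ^ n / n := by
  have hsmooth : ∀ m : ℕ, (∀ p : ℕ, p.Prime → p ∣ q * m → (p : ℝ) ≤ y) ↔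
      ∀ p : ℕ, p.Prime → p ∣ m → (p : ℝ) ≤ y := by
    refine fun m => ⟨fun h p hp hpm => h p hp (hpm.mul_left q), fun h p hp hpm => ?_⟩
    rcases hp.dvd_mul.1 hpm with hpq | hpm
    · rwa [(Nat.prime_dvd_prime_iff_eq hp hq).1 hpq]
    · exact h p hp hpm
  have hdvd : ∑ n ∈ (smoothUpTo y Z).filter (fun n : ℕ => ¬ n.Coprime q), ζ ^ n / n =
      (1 / q : ℂ) * ∑ n ∈ smoothUpTo y (Z / q), (ζ ^ q) ^ n / n := by
    have hset : (smoothUpTo y Z).filter (fun n : ℕ => ¬ n.Coprime q) =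
        ((Finset.Icc 1 Z).filter (q ∣ ·)).filter
          fun n : ℕ => ∀ p : ℕ, p.Prime → p ∣ n → (p : ℝ) ≤ y := by
      ext n
      rw [smoothUpTo, Finset.filter_comm, Finset.mem_filter, Finset.mem_filter,
        Finset.mem_filter, Finset.mem_filter, Nat.coprime_comm, hq.coprime_iff_not_dvd, not_not]
    rw [hset, Finset.sum_filter, sum_filter_dvd_Icc hq.pos, smoothUpTo, Finset.sum_filter,
      Finset.mul_sum]
    refine Finset.sum_congr rfl fun m _ => ?_
    simp only [hsmooth m]
    split_ifs
    · push_cast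
      rw [pow_mul, div_mul_div_comm, one_mul]
    · simp
  rw [← hdvd, ← Finset.sum_filter_add_sum_filter_not (smoothUpTo y Z) (fun n : ℕ => n.Coprime q)]
  ring

lemma norm_sum_smooth_sub_le {y : ℝ} {q : ℕ} (hq : 0 < q) (Z : ℕ) :
    ‖∑ n ∈ smoothUpTo y Z, (1 : ℂ) / n - ∑ n ∈ smoothUpTo y (Z / q), (1 : ℂ) / n‖ ≤ q := by
  have hset : (smoothUpTo y Z).filter (fun n : ℕ => n ≤ Z / q) = smoothUpTo y (Z / q) := by
    ext n
    have := Nat.div_le_self Z q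
    simp only [Finset.mem_filter, mem_smoothUpTo]
    grind
  rw [← Finset.sum_filter_add_sum_filter_not (smoothUpTo y Z) (fun n : ℕ => n ≤ Z / q), hset,
    add_sub_cancel_left]
  have hterm : ∀ n ∈ (smoothUpTo y Z).filter (fun n : ℕ => ¬ n ≤ Z / q),
      ‖(1 : ℂ) / n‖ ≤ 1 / ((Z / q : ℕ) + 1 : ℝ) := by
    intro n hn
    have hlt : Z / q + 1 ≤ n := by
      have := (Finset.mem_filter.1 hn).2
      lia
    rw [norm_div, norm_one, Complex.norm_natCast]
    gcongr
    exact_mod_cast hlt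
  refine (norm_sum_le_of_le _ hterm).trans ?_
  have hcard : ((smoothUpTo y Z).filter (fun n : ℕ => ¬ n ≤ Z / q)).card ≤ Z := by
    calc _ ≤ (smoothUpTo y Z).card := Finset.card_filter_le _ _
      _ ≤ (Finset.Icc 1 Z).card := Finset.card_filter_le _ _
      _ = Z := by simp
  have hZ : Z ≤ q * (Z / q + 1) := (Nat.lt_mul_div_succ Z hq).le
  rw [Finset.sum_const, nsmul_eq_mul, mul_one_div, div_le_iff₀ (by positivity)]
  exact_mod_cast hcard.trans hZ

lemma exists_norm_sum_smooth_coprime_add_le :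
    ∃ C Y : ℝ, 0 < C ∧ 3 ≤ Y ∧ ∀ (q : ℕ) (y : ℝ) (Z b : ℕ) (ζ : ℂ), q = 1 ∨ q.Prime → Y ≤ y →
      1 < b → (b : ℝ) ≤ Real.log y ^ (100 : ℕ) → IsPrimitiveRoot ζ b →
      ‖∑ n ∈ (smoothUpTo y Z).filter (fun n : ℕ => n.Coprime q), ζ ^ n / n +
        (if b = q then (1 : ℂ) else 0) / q.totient *
          ∑ n ∈ (smoothUpTo y Z).filter (fun n : ℕ => n.Coprime q), (1 : ℂ) / n‖ ≤
        C * Real.log (Real.log y) := by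
  obtain ⟨C, Y, hC, hY3, hCY⟩ := exists_norm_sum_smooth_le
  refine ⟨2 * C + 2, Y, by positivity, hY3, fun q y Z b ζ hq hy hb hby hζ => ?_⟩
  obtain ⟨hll, hbley, hS⟩ := hCY y Z b ζ hy hb hby hζ
  have hCll : 0 ≤ C * Real.log (Real.log y) := by positivity
  have hplain : (∀ n ∈ smoothUpTo y Z, n.Coprime q) → b ≠ q →
      ‖∑ n ∈ (smoothUpTo y Z).filter (fun n : ℕ => n.Coprime q), ζ ^ n / n +
        (if b = q then (1 : ℂ) else 0) / q.totient *
          ∑ n ∈ (smoothUpTo y Z).filter (fun n : ℕ => n.Coprime q), (1 : ℂ) / n‖ ≤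
        (2 * C + 2) * Real.log (Real.log y) := by
    intro hcop hbq
    rw [Finset.filter_true_of_mem hcop, if_neg hbq, zero_div, zero_mul, add_zero]
    linarith
  rcases hq with rfl | hq
  · exact hplain (fun n _ => Nat.coprime_one_right n) hb.ne'
  rcases lt_or_ge y (q : ℝ) with hqy | hqy
  · refine hplain (fun n hn => ?_) ?_
    · rw [Nat.coprime_comm, hq.coprime_iff_not_dvd]
      exact fun hdvd => absurd ((mem_smoothUpTo.1 hn).2 q hq hdvd) hqy.not_ge
    · rintro rfl
      exact absurd hbley hqy.not_ge
  have hq2 : (2 : ℝ) ≤ q := by exact_mod_cast hq.two_le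
  by_cases hbq : b = q
  · subst hbq
    have hφ : (b.totient : ℂ) = b - 1 := by
      rw [Nat.totient_prime hq, Nat.cast_sub hb.le, Nat.cast_one]
    have hb0 : (b : ℂ) ≠ 0 := by exact_mod_cast hq.ne_zero
    have hb1 : (b : ℂ) - 1 ≠ 0 := sub_ne_zero.2 (by exact_mod_cast hb.ne')
    have hone := sum_smooth_coprime_pow_div hq hqy Z 1
    simp only [one_pow] at hone
    rw [sum_smooth_coprime_pow_div hq hqy, hone, hζ.pow_eq_one, if_pos rfl, hφ]
    simp only [one_pow]
    have hsplit : ∀ S T U : ℂ, S - 1 / b * U + 1 / (b - 1) * (T - 1 / b * U) =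
        S + (T - U) / (b - 1) := by
      intro S T U
      field_simp
      ring
    rw [hsplit]
    have hdiff : ‖(∑ n ∈ smoothUpTo y Z, (1 : ℂ) / n -
        ∑ n ∈ smoothUpTo y (Z / b), (1 : ℂ) / n) / (b - 1)‖ ≤ 2 := by
      have hnorm : ‖(b : ℂ) - 1‖ = (b : ℝ) - 1 := by
        rw [← Nat.cast_one, ← Nat.cast_sub hb.le, Complex.norm_natCast, Nat.cast_sub hb.le,
          Nat.cast_one]
      rw [norm_div, hnorm, div_le_iff₀ (by linarith)]
      linarith [norm_sum_smooth_sub_le (y := y) hq.pos Z]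
    refine (norm_add_le _ _).trans ((add_le_add hS hdiff).trans ?_)
    linarith
  · have hsub : ‖∑ n ∈ smoothUpTo y (Z / q), (ζ ^ q) ^ n / n‖ ≤ C * Real.log (Real.log y) := by
      by_cases hqb : q ∣ b
      · obtain ⟨c, rfl⟩ := hqb
        have hc0 : c ≠ 0 := by rintro rfl; simp at hb
        have hc1 : c ≠ 1 := by rintro rfl; simp at hbq
        refine (hCY y (Z / q) c (ζ ^ q) hy (by lia) (le_trans ?_ hby) ?_).2.2
        · exact_mod_cast Nat.le_mul_of_pos_left c hq.pos
        · exact hζ.pow (by lia) rfl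
      · exact (hCY y (Z / q) b (ζ ^ q) hy hb hby
          (hζ.pow_of_coprime q ((hq.coprime_iff_not_dvd).2 hqb))).2.2
    rw [sum_smooth_coprime_pow_div hq hqy, if_neg hbq, zero_div, zero_mul, add_zero]
    have hscale : ‖(1 / q : ℂ) * ∑ n ∈ smoothUpTo y (Z / q), (ζ ^ q) ^ n / n‖ ≤
        C * Real.log (Real.log y) := by
      rw [norm_mul, norm_div, norm_one, Complex.norm_natCast]
      refine (mul_le_of_le_one_left (norm_nonneg _) ?_).trans hsub
      rw [div_le_one (by linarith)]
      linarith
    refine (norm_sub_le _ _).trans ((add_le_add hS hscale).trans ?_)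
    linarith

lemma isPrimitiveRoot_e2pi {a : ℤ} {b : ℕ} (hb : b ≠ 0) (hab : Int.gcd a b = 1) :
    IsPrimitiveRoot (e2pi ((a : ℝ) / b)) b := by
  have h := (Complex.isPrimitiveRoot_exp b hb).zpow_of_gcd_eq_one a hab
  rw [← Complex.exp_int_mul] at h
  have heq : e2pi ((a : ℝ) / b) = Complex.exp (a * (2 * Real.pi * Complex.I / b)) := by
    rw [e2pi]
    congr 1
    push_cast
    ring
  rwa [heq]

lemma e2pi_mul_div_eq_pow (a : ℤ) (b n : ℕ) :
    e2pi ((a : ℝ) * n / b) = e2pi ((a : ℝ) / b) ^ n := by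
  rw [e2pi, e2pi, ← Complex.exp_nat_mul]
  congr 1
  push_cast
  ring

lemma exists_norm_sum_smooth_coprime_add_le_of_le (Y : ℝ) :
    ∃ B : ℝ, 0 ≤ B ∧ ∀ (q : ℕ) (y : ℝ) (Z b : ℕ) (ζ : ℂ), y ≤ Y → ‖ζ‖ = 1 →
      ‖∑ n ∈ (smoothUpTo y Z).filter (fun n : ℕ => n.Coprime q), ζ ^ n / n +
        (if b = q then (1 : ℂ) else 0) / q.totient *
          ∑ n ∈ (smoothUpTo y Z).filter (fun n : ℕ => n.Coprime q), (1 : ℂ) / n‖ ≤ B := by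
  refine ⟨2 * max 0 (∏ p ∈ Finset.Ioc 0 ⌊Y⌋₊ with p.Prime, (1 - 1 / (p : ℝ))⁻¹),
    mul_nonneg zero_le_two (le_max_left _ _),
    fun q y Z b ζ hy hζ => ?_⟩
  set B := max 0 (∏ p ∈ Finset.Ioc 0 ⌊Y⌋₊ with p.Prime, (1 - 1 / (p : ℝ))⁻¹)
  have hbound : ∀ η : ℂ, ‖η‖ = 1 →
      ‖∑ n ∈ (smoothUpTo y Z).filter (fun n : ℕ => n.Coprime q), η ^ n / n‖ ≤ B := by
    intro η hη
    refine le_trans ?_ ((sum_smooth_one_div_le_prod hy Z).trans (le_max_right _ _))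
    calc ‖∑ n ∈ (smoothUpTo y Z).filter (fun n : ℕ => n.Coprime q), η ^ n / n‖
        ≤ ∑ n ∈ (smoothUpTo y Z).filter (fun n : ℕ => n.Coprime q), (1 : ℝ) / n :=
          norm_sum_le_of_le _ fun n _ => by simp [hη]
      _ ≤ ∑ n ∈ smoothUpTo y Z, (1 : ℝ) / n :=
          Finset.sum_le_sum_of_subset_of_nonneg (Finset.filter_subset _ _)
            fun _ _ _ => by positivity
  have hcoef : ‖(if b = q then (1 : ℂ) else 0) / q.totient‖ ≤ 1 := by
    split_ifs
    · simpa using Nat.cast_inv_le_one (α := ℝ) q.totient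
    · simp
  have hone := hbound 1 norm_one
  simp only [one_pow] at hone
  refine (norm_add_le _ _).trans ?_
  rw [norm_mul]
  have := mul_le_of_le_one_left (norm_nonneg (∑ n ∈ (smoothUpTo y Z).filter
    (fun n : ℕ => n.Coprime q), (1 : ℂ) / n)) hcoef
  linarith [hbound ζ hζ]

/-- Corollary 15: smooth exponential sums twisted by `e(na/b)`,
coprime to `q`. -/
theorem remove_exp_corollary :
    ∃ C : ℝ, 0 < C ∧
      ∀ q : ℕ, (q = 1 ∨ q.Prime) →
        ∀ (z y : ℝ) (a : ℤ) (b : ℕ), 2 ≤ z → 3 ≤ y → 1 < b →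
          (b : ℝ) ≤ Real.log y ^ (100 : ℕ) → Int.gcd a b = 1 →
          ‖(∑ n ∈ (Finset.Icc 1 ⌊z⌋₊).filter
                (fun n => n.Coprime q ∧ ∀ p : ℕ, p.Prime → p ∣ n → (p : ℝ) ≤ y),
                e2pi ((a : ℝ) * n / b) / n) +
              ((((if b = q then (1 : ℝ) else 0) / q.totient) *
                ∑ n ∈ (Finset.Icc 1 ⌊z⌋₊).filter
                    (fun n => n.Coprime q ∧ ∀ p : ℕ, p.Prime → p ∣ n → (p : ℝ) ≤ y),
                  (1 : ℝ) / n : ℝ) : ℂ)‖ ≤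
            C * (1 + ((if 1 < q then (1 : ℝ) else 0) / q) * ((b : ℝ) / b.totient)) *
              Real.log (Real.log y) := by
  obtain ⟨C, Y, hC, hY3, hCY⟩ := exists_norm_sum_smooth_coprime_add_le
  obtain ⟨B, hB, hBY⟩ := exists_norm_sum_smooth_coprime_add_le_of_le Y
  have hlog3 : 1 < Real.log 3 := by
    rw [Real.lt_log_iff_exp_lt (by norm_num)]
    exact Real.exp_one_lt_d9.trans (by norm_num)
  have hll3 : 0 < Real.log (Real.log 3) := Real.log_pos hlog3
  refine ⟨C + B / Real.log (Real.log 3), by positivity, ?_⟩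
  intro q hq z y a b _ hy hb hby hab
  have hll : Real.log (Real.log 3) ≤ Real.log (Real.log y) :=
    Real.log_le_log (by linarith) (Real.log_le_log (by norm_num) hy)
  have hζ := isPrimitiveRoot_e2pi (by lia : b ≠ 0) hab
  have hset : (Finset.Icc 1 ⌊z⌋₊).filter
      (fun n => n.Coprime q ∧ ∀ p : ℕ, p.Prime → p ∣ n → (p : ℝ) ≤ y) =
      (smoothUpTo y ⌊z⌋₊).filter (fun n : ℕ => n.Coprime q) := by
    ext n
    simp only [smoothUpTo, Finset.mem_filter]
    tauto
  have hcore : ‖∑ n ∈ (smoothUpTo y ⌊z⌋₊).filter (fun n : ℕ => n.Coprime q),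
        e2pi ((a : ℝ) / b) ^ n / n +
      (if b = q then (1 : ℂ) else 0) / q.totient *
        ∑ n ∈ (smoothUpTo y ⌊z⌋₊).filter (fun n : ℕ => n.Coprime q), (1 : ℂ) / n‖ ≤
      (C + B / Real.log (Real.log 3)) * Real.log (Real.log y) := by
    rw [add_mul]
    rcases le_total Y y with hYy | hyY
    · refine (hCY q y ⌊z⌋₊ b _ hq hYy hb hby hζ).trans (le_add_of_nonneg_right ?_)
      have := hll3.trans_le hll
      positivity
    · refine (hBY q y ⌊z⌋₊ b _ hyY (hζ.norm'_eq_one (by lia))).trans ?_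
      have h1 : B ≤ B / Real.log (Real.log 3) * Real.log (Real.log y) := by
        rw [div_mul_eq_mul_div, le_div_iff₀ hll3]
        gcongr
      have := mul_pos hC (hll3.trans_le hll)
      linarith
  rw [hset]
  simp only [e2pi_mul_div_eq_pow]
  push_cast
  rw [show ((if b = q then (1 : ℝ) else 0 : ℝ) : ℂ) = if b = q then (1 : ℂ) else 0 by
    split_ifs <;> simp]
  refine hcore.trans ?_
  have hll0 := hll3.le.trans hll
  gcongr
  refine le_mul_of_one_le_right (by positivity) (le_add_of_nonneg_right ?_)
  split_ifs <;> positivity
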